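/- arXiv:1501.03394 — 3 statements merged into one kernel-verified Lean document; each statement's English description precedes it below -/
import Mathlib

section
/- (Hermite–Biehler for real polynomials.) A real polynomial f(z) = p(z²) + z·q(z²) is Hurwitz stable (all zeros have negative real part) if and only if p(0)·q(0) > 0 and all zeros of p(z) and of z·q(z) are nonpositive and strictly interlacing. -/
open Polynomial

/-- The Jacobi polynomial `P_n^{(α,β)}` as a real polynomial in `x`. -/
noncomputable def jacobiP (α β : ℝ) (n : ℕ) : Polynomial ℝ :=
  C ((ascPochhammer ℝ n).eval (α + 1) / (n.factorial : ℝ)) *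
    ∑ k ∈ Finset.range (n + 1),
      C ((ascPochhammer ℝ k).eval (-(n : ℝ)) * (ascPochhammer ℝ k).eval ((n : ℝ) + α + β + 1) /
          ((k.factorial : ℝ) * (ascPochhammer ℝ k).eval (α + 1))) *
        (C (1 / 2 : ℝ) * (1 - X)) ^ k

/-- `φ_n^{(α,β)}(μ) = Σ_{k=0}^{[n/2]} (d/dx)^{2k} P_n^{(α,β)}(x)|_{x=1} · μ^k`. -/
noncomputable def phi (α β : ℝ) (n : ℕ) : Polynomial ℝ :=
  ∑ k ∈ Finset.range (n / 2 + 1),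
    C ((Polynomial.derivative^[2 * k] (jacobiP α β n)).eval 1) * X ^ k

/-- All complex zeros of `p` are real (i.e. `p` splits over `ℝ`). -/
def RealRooted (p : Polynomial ℝ) : Prop := (p.roots.card : ℕ) = p.natDegree

/-- All zeros of `p` are real and simple. -/
def AllRealSimple (p : Polynomial ℝ) : Prop := RealRooted p ∧ p.roots.Nodup

/-- Zeros of `g` and `h` interlace strictly. -/
def StrictlyInterlacing (g h : Polynomial ℝ) : Prop :=
  AllRealSimple g ∧ AllRealSimple h ∧
  (∀ x : ℝ, ¬(g.IsRoot x ∧ h.IsRoot x)) ∧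
  (∀ x y : ℝ, g.IsRoot x → g.IsRoot y → x < y →
      (∀ t : ℝ, g.IsRoot t → ¬(x < t ∧ t < y)) →
      ∃! z : ℝ, h.IsRoot z ∧ x < z ∧ z < y) ∧
  (∀ x y : ℝ, h.IsRoot x → h.IsRoot y → x < y →
      (∀ t : ℝ, h.IsRoot t → ¬(x < t ∧ t < y)) →
      ∃! z : ℝ, g.IsRoot z ∧ x < z ∧ z < y)

/-- `(g,h)` is a real pair: every real combination has only real zeros.
This is equivalent to non-strict interlacing of the zeros. -/
def RealPair (g h : Polynomial ℝ) : Prop :=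
  ∀ a b : ℝ, RealRooted (C a * g + C b * h)

/-- The zero of `p` closest to the origin, when all zeros of `p` are negative. -/
noncomputable def maxRoot (p : Polynomial ℝ) : ℝ := sSup {x : ℝ | p.IsRoot x}

/-- `f` is Hurwitz stable: all complex zeros lie in the open left half-plane. -/
def HurwitzStable (f : Polynomial ℝ) : Prop :=
  ∀ z : ℂ, Polynomial.aeval z f = 0 → z.re < 0

/-- If all complex roots of a nonzero real polynomial are real, it is real rooted. -/
theorem hb_realRooted (g : ℝ[X])
    (h : ∀ w : ℂ, aeval w g = 0 → ∃ x : ℝ, (x : ℂ) = w) : RealRooted g := by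
  unfold RealRooted
  rw [← splits_iff_card_roots]
  by_cases hg : g = 0
  · rw [hg]; exact Splits.zero
  refine Splits.of_splits_map (algebraMap ℝ ℂ) (IsAlgClosed.splits _) ?_
  intro a ha
  rw [mem_roots', IsRoot.def, eval_map_algebraMap] at ha
  obtain ⟨x, hx⟩ := h a ha.2
  exact ⟨x, hx⟩

theorem hb_nodup (g : ℝ[X]) (hg : g ≠ 0)
    (h : ∀ x, g.IsRoot x → g.derivative.eval x ≠ 0) : g.roots.Nodup := by
  rw [Multiset.nodup_iff_count_le_one]
  intro x
  by_contra hc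
  rw [not_le, count_roots, one_lt_rootMultiplicity_iff_isRoot hg] at hc
  exact h x hc.1 hc.2

theorem hb_deriv_ne (g : ℝ[X]) (hg : g ≠ 0) (h : g.roots.Nodup) (x : ℝ)
    (hx : g.IsRoot x) : g.derivative.eval x ≠ 0 := by
  intro hc
  have := (one_lt_rootMultiplicity_iff_isRoot hg).2 ⟨hx, hc⟩
  rw [← count_roots] at this
  have h2 := Multiset.nodup_iff_count_le_one.1 h x
  omega

/-- IVT: no roots on `[x,y]` means same sign. -/
theorem hb_same_sign (k : ℝ[X]) (x y : ℝ) (hxy : x < y)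
    (h : ∀ t, x ≤ t → t ≤ y → k.eval t ≠ 0) : 0 < k.eval x * k.eval y := by
  by_contra hc
  have hx := h x le_rfl hxy.le
  have hy := h y hxy.le le_rfl
  have hcont : ContinuousOn (fun t => k.eval t) (Set.Icc x y) := k.continuous.continuousOn
  have hne : k.eval x * k.eval y ≠ 0 := mul_ne_zero hx hy
  have hneg : k.eval x * k.eval y < 0 := lt_of_le_of_ne (not_lt.1 hc) hne
  rcases mul_neg_iff.1 hneg with ⟨h1, h2⟩ | ⟨h1, h2⟩
  · obtain ⟨t, ht, ht0⟩ := intermediate_value_Icc' hxy.le hcont ⟨h2.le, h1.le⟩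
    exact h t ht.1 ht.2 ht0
  · obtain ⟨t, ht, ht0⟩ := intermediate_value_Icc hxy.le hcont ⟨h1.le, h2.le⟩
    exact h t ht.1 ht.2 ht0

/-- consecutive roots: derivative signs are opposite. -/
theorem hb_consec (g : ℝ[X]) (x y : ℝ) (hxy : x < y) (hx : g.IsRoot x) (hy : g.IsRoot y)
    (h : ∀ t, x < t → t < y → ¬ g.IsRoot t) :
    g.derivative.eval x * g.derivative.eval y ≤ 0 := by
  obtain ⟨k, rfl⟩ := dvd_iff_isRoot.2 hx
  have hky : k.IsRoot y := by
    rw [IsRoot.def, eval_mul] at hy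
    rcases mul_eq_zero.1 hy with h1 | h1
    · simp at h1; linarith
    · exact h1
  obtain ⟨l, rfl⟩ := dvd_iff_isRoot.2 hky
  have e1 : (derivative ((X - C x) * ((X - C y) * l))).eval x = (x - y) * l.eval x := by
    simp [derivative_mul]
  have e2 : (derivative ((X - C x) * ((X - C y) * l))).eval y = (y - x) * l.eval y := by
    simp [derivative_mul]
  rw [e1, e2]
  by_contra hc
  push Not at hc
  have hl : l.eval x * l.eval y < 0 := by
    have h2 : 0 < (y - x) ^ 2 * (-(l.eval x * l.eval y)) := by nlinarith
    have h3 := pos_of_mul_pos_right h2 (sq_nonneg _)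
    linarith
  have : 0 < l.eval x * l.eval y := by
    apply hb_same_sign _ _ _ hxy
    intro t ht1 ht2 ht0
    rcases eq_or_lt_of_le ht1 with rfl | ht1
    · simp [ht0] at hl
    rcases eq_or_lt_of_le ht2 with rfl | ht2
    · simp [ht0] at hl
    exact h t ht1 ht2 (by simp [ht0])
  linarith

/-- Between two roots of `h` there is a root of `g`, if `g h' > 0` at the roots of `h`. -/
theorem hb_between (g h : ℝ[X]) (hh : h ≠ 0) (σ : ℝ)
    (hpos : ∀ x, h.IsRoot x → 0 < σ * (g.eval x * h.derivative.eval x))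
    (x y : ℝ) (hxy : x < y) (hx : h.IsRoot x) (hy : h.IsRoot y) :
    ∃ z, g.IsRoot z ∧ x < z ∧ z < y := by
  classical
  obtain ⟨a, ha, hxa, hmin⟩ := Finset.exists_next_right (s := h.roots.toFinset) (x := x)
    ⟨y, by simp [hh, hy.eq_zero], hxy⟩
  have haR : h.IsRoot a := by simpa [hh] using ha
  have hay : a ≤ y := hmin y (by simp [hh, hy.eq_zero]) hxy
  by_contra hc
  push Not at hc
  have h1 := hb_consec h x a hxa hx haR (fun t h1 h2 h3 =>
    absurd (hmin t (by simp [hh, h3.eq_zero]) h1) (not_le.2 h2))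
  have px := hpos x hx
  have pa := hpos a haR
  have h2 : 0 < g.eval x * g.eval a := by
    apply hb_same_sign _ _ _ hxa
    intro t ht1 ht2 ht0
    rcases eq_or_lt_of_le ht1 with rfl | ht1
    · simp [ht0] at px
    rcases eq_or_lt_of_le ht2 with rfl | ht2
    · simp [ht0] at pa
    have := hc t ht0 ht1
    linarith
  have h3 := mul_pos px pa
  have h4 : (0:ℝ) < (σ ^ 2 * (g.eval x * g.eval a)) *
      (h.derivative.eval x * h.derivative.eval a) := by nlinarith
  have h5 : 0 ≤ σ ^ 2 * (g.eval x * g.eval a) := by positivity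
  nlinarith [mul_nonneg h5 (neg_nonneg.2 h1)]

/-- existence and uniqueness. -/
theorem hb_between_unique (g h : ℝ[X]) (hg : g ≠ 0) (hh : h ≠ 0) (σ τ : ℝ)
    (hpos : ∀ x, h.IsRoot x → 0 < σ * (g.eval x * h.derivative.eval x))
    (gpos : ∀ x, g.IsRoot x → 0 < τ * (h.eval x * g.derivative.eval x))
    (x y : ℝ) (hx : h.IsRoot x) (hy : h.IsRoot y) (hxy : x < y)
    (hno : ∀ t : ℝ, h.IsRoot t → ¬(x < t ∧ t < y)) :
    ∃! z, g.IsRoot z ∧ x < z ∧ z < y := by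
  obtain ⟨z, hz, h1, h2⟩ := hb_between g h hh σ hpos x y hxy hx hy
  refine ⟨z, ⟨hz, h1, h2⟩, ?_⟩
  rintro w ⟨hw, h3, h4⟩
  rcases lt_trichotomy w z with hlt | heq | hgt
  · obtain ⟨t, ht, h5, h6⟩ := hb_between h g hg τ gpos w z hlt hw hz
    exact absurd ⟨by linarith, by linarith⟩ (hno t ht)
  · exact heq
  · obtain ⟨t, ht, h5, h6⟩ := hb_between h g hg τ gpos z w hgt hz hw
    exact absurd ⟨by linarith, by linarith⟩ (hno t ht)

/-- adjacent roots of different polynomials. -/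
theorem hb_step (g h : ℝ[X]) (x y : ℝ) (hxy : x < y) (hgx : g.IsRoot x) (hhy : h.IsRoot y)
    (hgx' : g.derivative.eval x ≠ 0) (hgy : g.eval y ≠ 0)
    (hhy' : h.derivative.eval y ≠ 0) (hhx : h.eval x ≠ 0)
    (hg : ∀ t, x < t → t < y → ¬ g.IsRoot t) (hh : ∀ t, x < t → t < y → ¬ h.IsRoot t) :
    0 < (-(g.derivative.eval x * h.eval x)) * (g.eval y * h.derivative.eval y) := by
  obtain ⟨k, rfl⟩ := dvd_iff_isRoot.2 hgx
  obtain ⟨l, rfl⟩ := dvd_iff_isRoot.2 hhy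
  have e1 : (derivative ((X - C x) * k)).eval x = k.eval x := by simp [derivative_mul]
  have e2 : (derivative ((X - C y) * l)).eval y = l.eval y := by simp [derivative_mul]
  have e3 : ((X - C x) * k).eval y = (y - x) * k.eval y := by simp
  have e4 : ((X - C y) * l).eval x = (x - y) * l.eval x := by simp
  rw [e1] at hgx'
  rw [e2] at hhy'
  rw [e3] at hgy
  rw [e4] at hhx
  rw [e1, e2, e3, e4]
  have k1 : 0 < k.eval x * k.eval y := by
    apply hb_same_sign _ _ _ hxy
    intro t ht1 ht2 ht0
    rcases eq_or_lt_of_le ht1 with rfl | ht1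
    · exact hgx' ht0
    rcases eq_or_lt_of_le ht2 with rfl | ht2
    · exact hgy (by simp [ht0])
    exact hg t ht1 ht2 (by simp [ht0])
  have l1 : 0 < l.eval x * l.eval y := by
    apply hb_same_sign _ _ _ hxy
    intro t ht1 ht2 ht0
    rcases eq_or_lt_of_le ht1 with rfl | ht1
    · exact hhx (by simp [ht0])
    rcases eq_or_lt_of_le ht2 with rfl | ht2
    · exact hhy' ht0
    exact hh t ht1 ht2 (by simp [ht0])
  have : 0 < (y - x) ^ 2 * ((k.eval x * k.eval y) * (l.eval x * l.eval y)) := by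
    have : 0 < y - x := by linarith
    positivity
  nlinarith

/-- Partial fractions argument. -/
theorem hb_pf (g k : ℝ[X]) (hg : g ≠ 0) (hr : AllRealSimple g) (hneg : ∀ x, g.IsRoot x → x ≤ 0)
    (hdeg : k.degree < g.degree)
    (hpos : ∀ x, g.IsRoot x → 0 < k.eval x * g.derivative.eval x)
    (z : ℂ) (hz0 : z ≠ 0) (hz : 0 ≤ z.re)
    (heq : z * aeval (z ^ 2) k = - aeval (z ^ 2) g) : False := by
  classical
  have hs : g.Splits := splits_iff_card_roots.2 hr.1
  set s := g.roots.toFinset with hsdef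
  have hmem : ∀ x, x ∈ s ↔ g.IsRoot x := by intro x; simp [hsdef, hg]
  let v : ℝ → ℂ := fun x => (x : ℂ)
  have hv : Set.InjOn v s := fun a _ b _ h => Complex.ofReal_injective h
  have hcard : s.card = g.natDegree := by
    rw [hsdef, Multiset.toFinset_card_of_nodup hr.2]; exact hr.1
  have hprod : g.map (algebraMap ℝ ℂ) = C (g.leadingCoeff : ℂ) * Lagrange.nodal s v := by
    conv_lhs => rw [hs.eq_prod_roots]
    rw [Polynomial.map_mul, Polynomial.map_multiset_prod, Lagrange.nodal, Finset.prod,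
      hsdef, Multiset.toFinset_val, Multiset.dedup_eq_self.2 hr.2, Multiset.map_map]
    simp [v]
  have hlc : (g.leadingCoeff : ℂ) ≠ 0 := by
    simpa using hg
  have hne : ∀ x ∈ s, z ^ 2 ≠ v x := by
    intro x hx hzx
    have hx' := (hmem x).1 hx
    have h1 : aeval (z ^ 2) g = 0 := by
      rw [hzx]
      change aeval (algebraMap ℝ ℂ x) g = 0
      rw [aeval_algebraMap_apply, coe_aeval_eq_eval, hx'.eq_zero, map_zero]
    have h2 : aeval (z ^ 2) k = 0 := by
      rw [h1, neg_zero] at heq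
      exact (mul_eq_zero.1 heq).resolve_left hz0
    rw [hzx] at h2
    change aeval (algebraMap ℝ ℂ x) k = 0 at h2
    rw [aeval_algebraMap_apply, coe_aeval_eq_eval] at h2
    have h3 : k.eval x = 0 := by simpa using h2
    have := hpos x hx'
    rw [h3] at this
    simp at this
  have hint : k.map (algebraMap ℝ ℂ) = Lagrange.interpolate s v (fun x => ((k.eval x : ℝ) : ℂ)) := by
    apply Lagrange.eq_interpolate_of_eval_eq _ hv
    · rw [degree_map, hcard, ← degree_eq_natDegree hg]; exact hdeg
    · intro i _
      change eval (algebraMap ℝ ℂ i) _ = _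
      rw [eval_map_algebraMap, aeval_algebraMap_apply, coe_aeval_eq_eval]
      rfl
  have hk : aeval (z ^ 2) k = (Lagrange.nodal s v).eval (z ^ 2) *
      ∑ x ∈ s, Lagrange.nodalWeight s v x * (z ^ 2 - v x)⁻¹ * ((k.eval x : ℝ) : ℂ) := by
    rw [← eval_map_algebraMap, hint, Lagrange.eval_interpolate_not_at_node _ hne]
  have hgz : aeval (z ^ 2) g = (g.leadingCoeff : ℂ) * (Lagrange.nodal s v).eval (z ^ 2) := by
    rw [← eval_map_algebraMap, hprod]; simp
  have hN : (Lagrange.nodal s v).eval (z ^ 2) ≠ 0 := by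
    rw [Lagrange.eval_nodal]
    exact Finset.prod_ne_zero_iff.2 fun x hx => sub_ne_zero.2 (hne x hx)
  have hw : ∀ x ∈ s, Lagrange.nodalWeight s v x =
      (g.leadingCoeff : ℂ) * ((g.derivative.eval x : ℝ) : ℂ)⁻¹ := by
    intro x hx
    rw [Lagrange.nodalWeight_eq_eval_derivative_nodal hx]
    have h1 : ((g.derivative.eval x : ℝ) : ℂ) =
        (g.leadingCoeff : ℂ) * eval (v x) (derivative (Lagrange.nodal s v)) := by
      have h2 := congrArg (fun P => eval (v x) (derivative P)) hprod
      simp only [derivative_map, derivative_mul, derivative_C, zero_mul, zero_add, eval_mul,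
        eval_C] at h2
      rw [← h2]
      change _ = eval (algebraMap ℝ ℂ x) _
      rw [eval_map_algebraMap, aeval_algebraMap_apply, coe_aeval_eq_eval]
      rfl
    rw [h1, mul_inv, ← mul_assoc, mul_inv_cancel₀ hlc, one_mul]
  have hsum : ∑ x ∈ s, (((k.eval x) * (g.derivative.eval x)⁻¹ : ℝ) : ℂ) * (z * (z ^ 2 - v x)⁻¹) = -1 := by
    have h1 : (Lagrange.nodal s v).eval (z ^ 2) * ((g.leadingCoeff : ℂ) *
        ∑ x ∈ s, (((k.eval x) * (g.derivative.eval x)⁻¹ : ℝ) : ℂ) * (z * (z ^ 2 - v x)⁻¹)) =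
        (Lagrange.nodal s v).eval (z ^ 2) * ((g.leadingCoeff : ℂ) * (-1)) := by
      have h2 : (Lagrange.nodal s v).eval (z ^ 2) * ((g.leadingCoeff : ℂ) * (-1)) =
         - aeval (z ^ 2) g := by rw [hgz]; ring
      rw [h2, ← heq, hk, mul_left_comm z]
      refine congrArg (fun t : ℂ => (Lagrange.nodal s v).eval (z ^ 2) * t) ?_
      rw [Finset.mul_sum, Finset.mul_sum]
      refine Finset.sum_congr rfl fun x hx => ?_
      rw [hw x hx]
      push_cast
      ring
    exact mul_left_cancel₀ hlc (mul_left_cancel₀ hN h1)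
  have hre := congrArg Complex.re hsum
  have hresum : ∀ F : ℝ → ℂ, (∑ x ∈ s, F x).re = ∑ x ∈ s, (F x).re :=
    fun F => Complex.re_sum s F
  rw [hresum] at hre
  have hnn : 0 ≤ ∑ x ∈ s, ((((k.eval x) * (g.derivative.eval x)⁻¹ : ℝ) : ℂ) * (z * (z ^ 2 - v x)⁻¹)).re := by
    refine Finset.sum_nonneg fun x hx => ?_
    rw [Complex.re_ofReal_mul]
    have hx' := (hmem x).1 hx
    have hA : 0 ≤ (k.eval x) * (g.derivative.eval x)⁻¹ := by
      have h1 := hpos x hx'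
      have h2 : g.derivative.eval x ≠ 0 := by
        intro h; rw [h] at h1; simp at h1
      have : (k.eval x) * (g.derivative.eval x)⁻¹ =
        (k.eval x * g.derivative.eval x) * ((g.derivative.eval x)⁻¹) ^ 2 := by
        field_simp
      rw [this]; positivity
    refine mul_nonneg hA ?_
    have hx0 := hneg x hx'
    rw [Complex.mul_re, Complex.inv_re, Complex.inv_im]
    have e : z.re * ((z ^ 2 - v x).re / Complex.normSq (z ^ 2 - v x)) -
      z.im * (-(z ^ 2 - v x).im / Complex.normSq (z ^ 2 - v x)) =
      (z.re * (z.re ^ 2 + z.im ^ 2 - x)) / Complex.normSq (z ^ 2 - v x) := by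
      simp [v, pow_two]
      ring
    rw [e]
    refine div_nonneg (mul_nonneg hz (by nlinarith [sq_nonneg z.re, sq_nonneg z.im])) (Complex.normSq_nonneg _)
  rw [hre] at hnn
  norm_num at hnn

theorem hb_prod_lt (s : Multiset ℂ) (z : ℂ) (hz : 0 < z.re) (hs : ∀ r ∈ s, r.re < 0) :
    (s ≠ 0 → (s.map fun r => ‖-(starRingEnd ℂ) z - r‖).prod < (s.map fun r => ‖z - r‖).prod) := by
  induction s using Multiset.induction_on with
  | empty => intro h; exact absurd rfl h
  | cons a s ih =>
    intro _
    have ha : a.re < 0 := hs a (by simp)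
    have hlt : ‖-(starRingEnd ℂ) z - a‖ < ‖z - a‖ := by
      rw [← sq_lt_sq₀ (norm_nonneg _) (norm_nonneg _), ← Complex.normSq_eq_norm_sq,
        ← Complex.normSq_eq_norm_sq, Complex.normSq_apply, Complex.normSq_apply]
      simp
      nlinarith [mul_pos hz (neg_pos.2 ha)]
    have hs' : ∀ r ∈ s, r.re < 0 := fun r hr => hs r (by simp [hr])
    rw [Multiset.map_cons, Multiset.map_cons, Multiset.prod_cons, Multiset.prod_cons]
    by_cases h0 : s = 0
    · subst h0; simpa using hlt
    · have h1 := ih hs' h0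
      have h2 : 0 ≤ (s.map fun r => ‖-(starRingEnd ℂ) z - r‖).prod := by
        apply Multiset.prod_nonneg
        intro x hx
        obtain ⟨r, _, rfl⟩ := Multiset.mem_map.1 hx
        exact norm_nonneg _
      exact mul_lt_mul'' hlt h1 (norm_nonneg _) h2

theorem hb_conj (f : ℝ[X]) (z : ℂ) :
    aeval ((starRingEnd ℂ) z) f = (starRingEnd ℂ) (aeval z f) := by
  have := Polynomial.aeval_algHom_apply (Complex.conjAe : ℂ →ₐ[ℝ] ℂ) z f
  simpa using this

theorem hb_norm_lt (f : ℝ[X]) (hdeg : 0 < f.natDegree) (hf : HurwitzStable f) (z : ℂ)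
    (hz : 0 < z.re) : ‖aeval (-z) f‖ < ‖aeval z f‖ := by
  have hf0 : f ≠ 0 := by rintro rfl; simp at hdeg
  have hF0 : f.map (algebraMap ℝ ℂ) ≠ 0 := by
    rwa [Polynomial.map_ne_zero_iff (algebraMap ℝ ℂ).injective]
  have hS : (f.map (algebraMap ℝ ℂ)).Splits := IsAlgClosed.splits _
  have e : ∀ w : ℂ, ‖aeval w f‖ = ‖(f.map (algebraMap ℝ ℂ)).leadingCoeff‖ *
      ((f.map (algebraMap ℝ ℂ)).roots.map fun r => ‖w - r‖).prod := by
    intro w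
    rw [← eval_map_algebraMap, hS.eval_eq_prod_roots, norm_mul]
    congr 1
    have h := map_multiset_prod (normHom : ℂ →*₀ ℝ)
      ((f.map (algebraMap ℝ ℂ)).roots.map fun r => w - r)
    rw [Multiset.map_map] at h
    exact h
  have h1 : ‖aeval (-z) f‖ = ‖aeval (-(starRingEnd ℂ) z) f‖ := by
    rw [← map_neg, hb_conj, RCLike.norm_conj]
  rw [h1, e, e]
  refine mul_lt_mul_of_pos_left ?_ (by simpa using hf0)
  apply hb_prod_lt _ _ hz
  · intro r hr
    rw [mem_roots hF0, IsRoot.def, eval_map_algebraMap] at hr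
    exact hf r hr
  · apply hS.roots_ne_zero
    rw [natDegree_map]; omega

theorem hb_logderiv (f : ℝ[X]) (hdeg : 0 < f.natDegree) (hf : HurwitzStable f) (z : ℂ)
    (hz : z.re = 0) :
    0 < (aeval z f.derivative * (starRingEnd ℂ) (aeval z f)).re := by
  have hf0 : f ≠ 0 := by rintro rfl; simp at hdeg
  have hF0 : f.map (algebraMap ℝ ℂ) ≠ 0 := by
    rwa [Polynomial.map_ne_zero_iff (algebraMap ℝ ℂ).injective]
  have hS : (f.map (algebraMap ℝ ℂ)).Splits := IsAlgClosed.splits _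
  have hz0 : aeval z f ≠ 0 := fun h => by have := hf z h; linarith
  have h1 := hS.eval_derivative_div_eval_of_ne_zero (x := z) (by rwa [eval_map_algebraMap])
  rw [derivative_map, eval_map_algebraMap, eval_map_algebraMap] at h1
  have h2 : 0 < (aeval z f.derivative / aeval z f).re := by
    rw [h1]
    have : (((f.map (algebraMap ℝ ℂ)).roots.map fun r => 1 / (z - r)).sum).re =
       (((f.map (algebraMap ℝ ℂ)).roots.map fun r => (1 / (z - r)).re).sum) := by
      have := map_multiset_sum Complex.reAddGroupHom
        ((f.map (algebraMap ℝ ℂ)).roots.map fun r => 1 / (z - r))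
      rw [Multiset.map_map] at this
      exact this
    rw [this]
    have hne : (f.map (algebraMap ℝ ℂ)).roots ≠ 0 := by
      apply hS.roots_ne_zero
      rw [natDegree_map]; omega
    have : (0:ℝ) = ((f.map (algebraMap ℝ ℂ)).roots.map fun r => (0:ℝ)).sum := by simp
    rw [this]
    apply Multiset.sum_lt_sum_of_nonempty hne
    intro r hr
    rw [mem_roots hF0, IsRoot.def, eval_map_algebraMap] at hr
    have hrn := hf r hr
    rw [one_div, Complex.inv_re]
    have : z - r ≠ 0 := by
      intro h
      have := congrArg Complex.re h
      simp at this
      linarith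
    refine div_pos ?_ (Complex.normSq_pos.2 this)
    simp; linarith
  have h3 : aeval z f.derivative * (starRingEnd ℂ) (aeval z f) =
      (aeval z f.derivative / aeval z f) * ((Complex.normSq (aeval z f) : ℝ) : ℂ) := by
    rw [← Complex.mul_conj]; field_simp
  rw [h3, Complex.re_mul_ofReal]
  exact mul_pos h2 (Complex.normSq_pos.2 hz0)

/-- Signs at all roots from interlacing. -/
theorem hb_signs (g h : ℝ[X]) (hg0 : g ≠ 0) (hh0 : h ≠ 0) (H : StrictlyInterlacing g h)
    (hgn : ∀ x, g.IsRoot x → x < 0) (h0 : h.IsRoot 0)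
    (hhn : ∀ x, h.IsRoot x → x ≤ 0)
    (hpos : 0 < g.eval 0 * h.derivative.eval 0) (x : ℝ) (hx : g.IsRoot x ∨ h.IsRoot x) :
    0 < g.eval x * h.derivative.eval x - g.derivative.eval x * h.eval x := by
  classical
  obtain ⟨hg, hh, hno, hgh, hhg⟩ := H
  by_contra hbad
  set D : ℝ → ℝ := fun x => g.eval x * h.derivative.eval x - g.derivative.eval x * h.eval x with hD
  set s := g.roots.toFinset ∪ h.roots.toFinset with hs
  have hmem : ∀ x, x ∈ s ↔ (g.IsRoot x ∨ h.IsRoot x) := by intro x; simp [hs, hg0, hh0]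
  set b := s.filter (fun x => ¬ 0 < D x) with hb
  have hbne : b.Nonempty := ⟨x, Finset.mem_filter.2 ⟨(hmem x).2 hx, hbad⟩⟩
  obtain ⟨m, hm, hmax⟩ := b.exists_maximal hbne
  obtain ⟨hms, hmD⟩ := Finset.mem_filter.1 hm
  have hm0 : m < 0 := by
    rcases (hmem m).1 hms with h1 | h1
    · exact hgn m h1
    · refine lt_of_le_of_ne (hhn m h1) ?_
      rintro rfl
      apply hmD
      simp only [hD, h0.eq_zero, mul_zero, sub_zero]
      exact hpos
  obtain ⟨y, hy, hmy, hmin⟩ := Finset.exists_next_right (s := s) (x := m)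
    ⟨0, (hmem 0).2 (Or.inr h0), hm0⟩
  have hyD : 0 < D y := by
    by_contra hc
    have := hmax (Finset.mem_filter.2 ⟨hy, hc⟩) hmy.le
    linarith
  have ng : ∀ t, m < t → t < y → ¬ g.IsRoot t := fun t h1 h2 h3 =>
    absurd (hmin t ((hmem t).2 (Or.inl h3)) h1) (not_le.2 h2)
  have nh : ∀ t, m < t → t < y → ¬ h.IsRoot t := fun t h1 h2 h3 =>
    absurd (hmin t ((hmem t).2 (Or.inr h3)) h1) (not_le.2 h2)
  have dg := hb_deriv_ne g hg0 hg.2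
  have dh := hb_deriv_ne h hh0 hh.2
  apply hmD
  rcases (hmem m).1 hms with h1 | h1 <;> rcases (hmem y).1 hy with h2 | h2
  · obtain ⟨z, ⟨h3, h4, h5⟩, _⟩ := hgh m y h1 h2 hmy (fun t ht h => ng t h.1 h.2 ht)
    exact absurd h3 (nh z h4 h5)
  · have := hb_step g h m y hmy h1 h2 (dg m h1) (fun h => hno y ⟨h, h2⟩) (dh y h2)
      (fun h => hno m ⟨h1, h⟩) ng nh
    have e1 : D m = -(g.derivative.eval m * h.eval m) := by simp [hD, h1.eq_zero]
    have e2 : D y = g.eval y * h.derivative.eval y := by simp [hD, h2.eq_zero]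
    rw [← e1, ← e2] at this
    exact pos_of_mul_pos_left this hyD.le
  · have := hb_step h g m y hmy h1 h2 (dh m h1) (fun h => hno y ⟨h2, h⟩) (dg y h2)
      (fun h => hno m ⟨h, h1⟩) nh ng
    have e1 : D m = (h.derivative.eval m * g.eval m) := by simp [hD, h1.eq_zero]; ring
    have e2 : D y = - (h.eval y * g.derivative.eval y) := by simp [hD, h2.eq_zero]; ring
    have e3 : 0 < D m * D y := by rw [e1, e2]; linarith
    exact pos_of_mul_pos_left e3 hyD.le
  · obtain ⟨z, ⟨h3, h4, h5⟩, _⟩ := hhg m y h1 h2 hmy (fun t ht h => nh t h.1 h.2 ht)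
    exact absurd h3 (ng z h4 h5)

theorem hb_aeval (p q : ℝ[X]) (z : ℂ) :
    aeval z (p.comp (X ^ 2) + X * q.comp (X ^ 2)) = aeval (z ^ 2) p + z * aeval (z ^ 2) q := by
  simp [aeval_comp]

theorem hb_backward (p q : ℝ[X]) (hpq : 0 < p.eval 0 * q.eval 0)
    (hp : ∀ x ∈ p.roots, x ≤ 0) (hq : ∀ x ∈ (X * q).roots, x ≤ 0)
    (H : StrictlyInterlacing p (X * q)) :
    HurwitzStable (p.comp (X ^ 2) + X * q.comp (X ^ 2)) := by
  classical
  intro z hz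
  rw [hb_aeval] at hz
  by_contra hre
  push Not at hre
  have hp00 : p.eval 0 ≠ 0 := fun h => by simp [h] at hpq
  have hq00 : q.eval 0 ≠ 0 := fun h => by simp [h] at hpq
  have hp0 : p ≠ 0 := by rintro rfl; simp at hp00
  have hq0 : q ≠ 0 := by rintro rfl; simp at hq00
  have hh0 : X * q ≠ 0 := mul_ne_zero X_ne_zero hq0
  have hpn : ∀ x, p.IsRoot x → x < 0 := fun x hx =>
    lt_of_le_of_ne (hp x ((mem_roots hp0).2 hx)) (by rintro rfl; exact hp00 hx)
  have hhn : ∀ x, (X * q).IsRoot x → x ≤ 0 := fun x hx => hq x ((mem_roots hh0).2 hx)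
  have hz0 : z ≠ 0 := by
    rintro rfl
    have : aeval (algebraMap ℝ ℂ 0) p = 0 := by simpa using hz
    rw [aeval_algebraMap_apply, coe_aeval_eq_eval] at this
    exact hp00 (by simpa using this)
  have S := hb_signs p (X * q) hp0 hh0 H hpn (by simp) hhn
    (by simpa [derivative_mul] using hpq)
  -- degrees
  have hdeg : p.natDegree ≤ q.natDegree + 1 := by
    have h1 : p.natDegree = p.roots.toFinset.card := by
      rw [Multiset.toFinset_card_of_nodup H.1.2]; exact H.1.1.symm
    have h2 : p.roots.toFinset.card ≤ q.roots.toFinset.card + 1 := by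
      apply Finset.card_le_of_interleaved
      intro x hx y hy hxy hno
      have hx' : p.IsRoot x := by simpa [hp0] using hx
      have hy' : p.IsRoot y := by simpa [hp0] using hy
      obtain ⟨w, ⟨h3, h4, h5⟩, _⟩ := H.2.2.2.1 x y hx' hy' hxy
        (fun t ht h => hno t (by simp [hp0, ht.eq_zero]) h)
      refine ⟨w, ?_, h4, h5⟩
      have hw : w ≠ 0 := by have := hpn y hy'; intro h; linarith
      have : q.eval w = 0 := by simpa [hw] using h3
      simp [hq0, this]
    have h3 : q.roots.toFinset.card ≤ q.natDegree :=
      (Multiset.toFinset_card_le _).trans (card_roots' q)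
    omega
  have hXq : (X * q).natDegree = q.natDegree + 1 := natDegree_X_mul hq0
  rcases Nat.lt_or_ge q.natDegree p.natDegree with hlt | hge
  · refine hb_pf p q hp0 H.1 (fun x hx => (hpn x hx).le) (degree_lt_degree hlt) ?_ z hz0 hre ?_
    · intro x hx
      have h1 := S x (Or.inl hx)
      have h2 := hpn x hx
      rw [hx.eq_zero] at h1
      simp at h1
      by_contra hc
      push Not at hc
      nlinarith [mul_nonneg (neg_nonneg.2 h2.le) (neg_nonneg.2 hc)]
    · linear_combination hz
  · refine hb_pf (X * q) p hh0 H.2.1 hhn (degree_lt_degree (by omega)) ?_ z hz0 hre ?_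
    · intro x hx
      have h1 := S x (Or.inr hx)
      rw [hx.eq_zero] at h1
      linarith
    · rw [map_mul, aeval_X]
      linear_combination z * hz

theorem hb_key (p q : ℝ[X]) (hdeg : 0 < (p.comp (X ^ 2) + X * q.comp (X ^ 2)).natDegree)
    (hf : HurwitzStable (p.comp (X ^ 2) + X * q.comp (X ^ 2))) (x : ℝ) (hx : x ≤ 0) :
    0 < p.eval x * q.eval x +
      2 * x * (p.eval x * q.derivative.eval x - p.derivative.eval x * q.eval x) := by
  have hy := Real.sq_sqrt (neg_nonneg.2 hx)
  set y := Real.sqrt (-x)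
  have h := hb_logderiv _ hdeg hf (y * Complex.I) (by simp)
  have hz2 : ((y : ℂ) * Complex.I) ^ 2 = algebraMap ℝ ℂ x := by
    rw [mul_pow, Complex.I_sq, ← Complex.ofReal_pow, hy]; simp
  have hd : derivative (p.comp (X ^ 2) + X * q.comp (X ^ 2)) =
      2 * X * p.derivative.comp (X ^ 2) + q.comp (X ^ 2) +
        2 * X ^ 2 * q.derivative.comp (X ^ 2) := by
    simp [derivative_comp, derivative_mul]
    ring
  have ev : ∀ r : ℝ[X], aeval (algebraMap ℝ ℂ x) r = ((r.eval x : ℝ) : ℂ) := by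
    intro r
    rw [aeval_algebraMap_apply, coe_aeval_eq_eval]; rfl
  rw [hb_aeval, hd] at h
  simp only [map_add, map_mul, aeval_comp, map_pow, aeval_X, hz2, ev, map_ofNat] at h
  simp at h
  refine lt_of_lt_of_eq h ?_
  linear_combination (2 * p.derivative.eval x * q.eval x) * hy

theorem hb_root_neg (p q : ℝ[X]) (hdeg : 0 < (p.comp (X ^ 2) + X * q.comp (X ^ 2)).natDegree)
    (hf : HurwitzStable (p.comp (X ^ 2) + X * q.comp (X ^ 2))) (w : ℂ)
    (hw : aeval w p = 0 ∨ aeval w q = 0) : ∃ x : ℝ, (x : ℂ) = w ∧ x ≤ 0 := by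
  obtain ⟨z, hz⟩ := IsAlgClosed.exists_pow_nat_eq w (n := 2) (by norm_num)
  have key : ∀ z : ℂ, z ^ 2 = w → ¬ 0 < z.re := by
    intro z hz hpos
    have h := hb_norm_lt _ hdeg hf z hpos
    rw [hb_aeval, hb_aeval, neg_sq, hz] at h
    rcases hw with h0 | h0 <;> simp [h0] at h
  have h1 := key z hz
  have h2 := key (-z) (by rw [neg_sq, hz])
  have h3 : z.re = 0 := by simp at h1 h2; linarith
  refine ⟨-(z.im ^ 2), ?_, by nlinarith [sq_nonneg z.im]⟩
  rw [← hz]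
  apply Complex.ext <;> simp [pow_two, h3]

theorem hb_forward (p q : ℝ[X]) (hdeg : 0 < (p.comp (X ^ 2) + X * q.comp (X ^ 2)).natDegree)
    (hf : HurwitzStable (p.comp (X ^ 2) + X * q.comp (X ^ 2))) :
    (0 < p.eval 0 * q.eval 0 ∧
        (∀ x ∈ p.roots, x ≤ 0) ∧ (∀ x ∈ (X * q).roots, x ≤ 0) ∧
        StrictlyInterlacing p (X * q)) := by
  have key := hb_key p q hdeg hf
  have rn := hb_root_neg p q hdeg hf
  have hpq : 0 < p.eval 0 * q.eval 0 := by simpa using key 0 le_rfl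
  have hp00 : p.eval 0 ≠ 0 := fun h => by simp [h] at hpq
  have hq00 : q.eval 0 ≠ 0 := fun h => by simp [h] at hpq
  have hp0 : p ≠ 0 := by rintro rfl; simp at hp00
  have hq0 : q ≠ 0 := by rintro rfl; simp at hq00
  have hh0 : X * q ≠ 0 := mul_ne_zero X_ne_zero hq0
  have ev : ∀ (r : ℝ[X]) (x : ℝ), r.IsRoot x → aeval (x : ℂ) r = 0 := by
    intro r x hr
    change aeval (algebraMap ℝ ℂ x) r = 0
    rw [aeval_algebraMap_apply, coe_aeval_eq_eval, hr.eq_zero, map_zero]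
  have hpn : ∀ x, p.IsRoot x → x < 0 := by
    intro x hx
    obtain ⟨x', h1, h2⟩ := rn x (Or.inl (ev p x hx))
    have h1 : x' = x := by exact_mod_cast h1
    subst h1
    exact lt_of_le_of_ne h2 (by rintro rfl; exact hp00 hx)
  have hqn : ∀ x, q.IsRoot x → x < 0 := by
    intro x hx
    obtain ⟨x', h1, h2⟩ := rn x (Or.inr (ev q x hx))
    have h1 : x' = x := by exact_mod_cast h1
    subst h1
    exact lt_of_le_of_ne h2 (by rintro rfl; exact hq00 hx)
  have hhr : ∀ x, (X * q).IsRoot x → x = 0 ∨ q.IsRoot x := by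
    intro x hx; simpa using hx
  have hhn : ∀ x, (X * q).IsRoot x → x ≤ 0 := by
    intro x hx
    rcases hhr x hx with h | h
    · exact h.le
    · exact (hqn x h).le
  have gpos : ∀ x, p.IsRoot x → 0 < (-1) * ((X * q).eval x * p.derivative.eval x) := by
    intro x hx
    have h1 := key x (hpn x hx).le
    rw [hx.eq_zero] at h1
    simp
    linarith
  have hpos : ∀ x, (X * q).IsRoot x → 0 < 1 * (p.eval x * (X * q).derivative.eval x) := by
    intro x hx
    rcases hhr x hx with rfl | h
    · simpa [derivative_mul] using hpq
    · have h1 := key x (hqn x h).le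
      rw [h.eq_zero] at h1
      simp [derivative_mul, h.eq_zero]
      linarith
  refine ⟨hpq, fun x hx => (hpn x ((mem_roots hp0).1 hx)).le,
    fun x hx => hhn x ((mem_roots hh0).1 hx), ⟨?_, ?_⟩, ⟨?_, ?_⟩, ?_, ?_, ?_⟩
  · apply hb_realRooted
    intro w hw
    obtain ⟨x, hx, _⟩ := rn w (Or.inl hw)
    exact ⟨x, hx⟩
  · apply hb_nodup p hp0
    intro x hx h
    have := gpos x hx
    simp [h] at this
  · apply hb_realRooted
    intro w hw
    rw [map_mul, aeval_X] at hw
    rcases mul_eq_zero.1 hw with h | h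
    · exact ⟨0, by simp [h]⟩
    · obtain ⟨x, hx, _⟩ := rn w (Or.inr h)
      exact ⟨x, hx⟩
  · apply hb_nodup _ hh0
    intro x hx h
    have := hpos x hx
    rw [h] at this
    simp at this
  · rintro x ⟨h1, h2⟩
    have := gpos x h1
    rw [h2.eq_zero] at this
    simp at this
  · exact fun x y hx hy hxy hno =>
      hb_between_unique (X * q) p hh0 hp0 (-1) 1 gpos hpos x y hx hy hxy hno
  · exact fun x y hx hy hxy hno =>
      hb_between_unique p (X * q) hp0 hh0 1 (-1) hpos gpos x y hx hy hxy hno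

/-- Hermite–Biehler: `f(z) = p(z²) + z·q(z²)` is Hurwitz stable iff `p(0)·q(0) > 0` and the
zeros of `p` and `z·q(z)` are nonpositive and strictly interlacing. -/
theorem hermite_biehler (p q f : Polynomial ℝ)
    (hf : f = p.comp (X ^ 2) + X * q.comp (X ^ 2)) (hdeg : 0 < f.natDegree) :
    HurwitzStable f ↔
      (0 < p.eval 0 * q.eval 0 ∧
        (∀ x ∈ p.roots, x ≤ 0) ∧ (∀ x ∈ (X * q).roots, x ≤ 0) ∧
        StrictlyInterlacing p (X * q)) := by
  subst hf
  exact ⟨hb_forward p q hdeg, fun ⟨h1, h2, h3, h4⟩ => hb_backward p q h1 h2 h3 h4⟩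
end

section
/- Let α > −1, n + α + β > 0, n ≥ 4, and define φ_m^{(α,β)}(μ) := Σ_{k=0}^{[m/2]} [(d/dx)^{2k} P_m^{(α,β)}(x)]|_{x=1} · μ^k. If φ_n^{(α,β−1)} has only real zeros, then all zeros of φ_n^{(α,β)} and φ_{n−1}^{(α,β)} are negative, these two polynomials' zeros interlace non-strictly, and the zero of φ_{n−1}^{(α,β)} closest to the origin is no closer than the zero of φ_n^{(α,β)} closest to the origin. -/
open Polynomial

noncomputable def auxD (α β : ℝ) (n j : ℕ) : ℝ :=
  (ascPochhammer ℝ n).eval (α + 1) / (n.factorial : ℝ) *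
    ((n.descFactorial j : ℝ) * (ascPochhammer ℝ j).eval ((n : ℝ) + α + β + 1) /
      (ascPochhammer ℝ j).eval (α + 1)) / 2 ^ j

lemma aux_deriv (α β : ℝ) (n j : ℕ) :
    (Polynomial.derivative^[j] (jacobiP α β n)).eval 1 = auxD α β n j := by
  have h1 : (Polynomial.derivative^[j] (jacobiP α β n)).eval 1
      = (j.factorial : ℝ) * (taylor 1 (jacobiP α β n)).coeff j := by
    rw [taylor_coeff, ← factorial_smul_hasseDeriv]
    simp
  have h2 : taylor 1 (jacobiP α β n) =
      C ((ascPochhammer ℝ n).eval (α + 1) / (n.factorial : ℝ)) *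
    ∑ k ∈ Finset.range (n + 1),
      C ((ascPochhammer ℝ k).eval (-(n : ℝ)) * (ascPochhammer ℝ k).eval ((n : ℝ) + α + β + 1) /
          ((k.factorial : ℝ) * (ascPochhammer ℝ k).eval (α + 1)) * (-1 / 2) ^ k) * X ^ k := by
    unfold jacobiP
    rw [taylor_apply, mul_comp, C_comp, Polynomial.sum_comp]
    congr 1
    refine Finset.sum_congr rfl fun k _ => ?_
    rw [mul_comp, C_comp, pow_comp, C_mul, mul_assoc]
    congr 1
    have : (C (1 / 2 : ℝ) * (1 - X)).comp (X + C 1) = C (-1 / 2 : ℝ) * X := by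
      rw [mul_comp, C_comp, sub_comp, one_comp, X_comp, neg_div, C_neg]
      simp
    rw [this, mul_pow, C_pow]
  rw [h1, h2, coeff_C_mul, finsetSum_coeff]
  simp only [coeff_C_mul, coeff_X_pow, mul_ite, mul_one, mul_zero]
  rw [Finset.sum_ite_eq]
  unfold auxD
  rw [ascPochhammer_eval_neg_eq_descPochhammer, descPochhammer_eval_eq_descFactorial]
  split_ifs with hj
  · have e : (-1 / 2 : ℝ) ^ j = (-1) ^ j / 2 ^ j := div_pow _ _ _
    have e2 : ((-1 : ℝ) ^ j) * (-1) ^ j = 1 := by rw [← mul_pow]; simp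
    have hf : (j.factorial : ℝ) ≠ 0 := by positivity
    rw [e]
    have : ∀ A d s a t f u : ℝ, f ≠ 0 → u * u = 1 →
      f * (A * (u * d * s / (f * a) * (u / t))) = A * (d * s / a) / t := by
      intro A d s a t f u hf hu
      have : f * (A * (u * d * s / (f * a) * (u / t))) = (f / f) * (u * u) * (A * (d * s / a) / t) := by
        simp only [div_eq_mul_inv, mul_inv]; ring
      rw [this, hu, div_self hf]; ring
    exact this _ _ _ _ _ _ _ hf e2
  · have : n.descFactorial j = 0 := Nat.descFactorial_eq_zero_iff_lt.2 (by simpa using hj)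
    simp [this]

lemma aux_coeff (α β : ℝ) (n k : ℕ) : (phi α β n).coeff k = auxD α β n (2 * k) := by
  unfold phi
  rw [finsetSum_coeff]
  simp only [coeff_C_mul, coeff_X_pow, mul_ite, mul_one, mul_zero, aux_deriv]
  rw [Finset.sum_ite_eq]
  split_ifs with hj
  · rfl
  · have : n.descFactorial (2 * k) = 0 := Nat.descFactorial_eq_zero_iff_lt.2 (by
      simp at hj; omega)
    simp [auxD, this]

lemma auxD_pos (α β : ℝ) (n j : ℕ) (hα : -1 < α) (h : 0 < (n : ℝ) + α + β + 1) (hj : j ≤ n) :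
    0 < auxD α β n j := by
  unfold auxD
  have h1 := ascPochhammer_pos n (α + 1) (by linarith)
  have h2 := ascPochhammer_pos j (α + 1) (by linarith)
  have h3 := ascPochhammer_pos j _ h
  have h4 : 0 < (n.descFactorial j : ℝ) := by
    exact_mod_cast Nat.pos_of_ne_zero (fun h => by
      rw [Nat.descFactorial_eq_zero_iff_lt] at h; omega)
  positivity

lemma auxD_nonneg (α β : ℝ) (n j : ℕ) (hα : -1 < α) (h : 0 < (n : ℝ) + α + β + 1) :
    0 ≤ auxD α β n j := by
  rcases le_or_gt j n with hj | hj
  · exact (auxD_pos α β n j hα h hj).le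
  · simp [auxD, Nat.descFactorial_eq_zero_iff_lt.2 hj]

lemma phi_eval_pos (α β : ℝ) (n : ℕ) (hα : -1 < α) (h : 0 < (n : ℝ) + α + β + 1)
    (x : ℝ) (hx : 0 ≤ x) : 0 < (phi α β n).eval x := by
  unfold phi
  simp only [aux_deriv, eval_finsetSum, eval_mul, eval_C, eval_pow, eval_X]
  rw [Finset.sum_range_succ']
  have := auxD_pos α β n (2 * 0) hα h (by simp)
  have h2 : 0 ≤ ∑ k ∈ Finset.range (n / 2), auxD α β n (2 * (k + 1)) * x ^ (k + 1) :=
    Finset.sum_nonneg fun k _ => mul_nonneg (auxD_nonneg _ _ _ _ hα h) (by positivity)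
  simp only [pow_zero, mul_one]
  linarith

lemma coeff_X_mul_deriv (p : ℝ[X]) (k : ℕ) : (X * derivative p).coeff k = k * p.coeff k := by
  cases k with
  | zero => simp
  | succ k => rw [coeff_X_mul, coeff_derivative]; push_cast; ring

lemma phi_id1 (α β : ℝ) (n : ℕ) :
    C ((n : ℝ) + α + β) * phi α β n =
      C ((n : ℝ) + α + β) * phi α (β - 1) n + C 2 * (X * derivative (phi α (β - 1) n)) := by
  ext k
  rw [coeff_add, coeff_C_mul, coeff_C_mul, coeff_C_mul, coeff_X_mul_deriv, aux_coeff, aux_coeff]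
  unfold auxD
  have e1 : (n : ℝ) + α + (β - 1) + 1 = n + α + β := by ring
  rw [e1]
  have key : ∀ s : ℝ, s * (ascPochhammer ℝ (2 * k)).eval (s + 1) =
      (ascPochhammer ℝ (2 * k)).eval s * (s + (2 * k : ℕ)) := by
    intro s
    rw [← ascPochhammer_succ_eval, ascPochhammer_succ_left]
    simp
  have := key ((n : ℝ) + α + β)
  push_cast at this
  linear_combination ((ascPochhammer ℝ n).eval (α + 1) / (n.factorial : ℝ) *
    ((n.descFactorial (2 * k) : ℝ)  /
      (ascPochhammer ℝ (2 * k)).eval (α + 1)) / 2 ^ (2 * k)) * this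

lemma phi_id2 (α β : ℝ) (N : ℕ) (hα : -1 < α) :
    C ((N : ℝ) + 1 + α) * phi α β N =
      C ((N : ℝ) + 1) * phi α (β - 1) (N + 1) - C 2 * (X * derivative (phi α (β - 1) (N + 1))) := by
  ext k
  rw [coeff_sub, coeff_C_mul, coeff_C_mul, coeff_C_mul, coeff_X_mul_deriv, aux_coeff, aux_coeff]
  unfold auxD
  have e1 : ((N + 1 : ℕ) : ℝ) + α + (β - 1) + 1 = N + α + β + 1 := by push_cast; ring
  rw [e1, ascPochhammer_succ_eval, Nat.factorial_succ]
  have key : (((N + 1 : ℕ) : ℝ) - (2 * k : ℕ)) * ((N + 1).descFactorial (2 * k) : ℝ) =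
      ((N + 1 : ℕ) : ℝ) * N.descFactorial (2 * k) := by
    rcases le_or_gt (2 * k) (N + 1) with hk | hk
    · rw [← Nat.cast_sub hk]
      exact_mod_cast Nat.succ_descFactorial N (2 * k)
    · rw [Nat.descFactorial_eq_zero_iff_lt.2 hk, Nat.descFactorial_eq_zero_iff_lt.2 (by omega)]
      simp
  push_cast at key ⊢
  have hN : (N : ℝ) + 1 ≠ 0 := by positivity
  have hf : (N.factorial : ℝ) ≠ 0 := by positivity
  have h2 := (ascPochhammer_pos (2 * k) (α + 1) (by linarith)).ne'
  field_simp
  linear_combination (-((N + 1 + α) * (ascPochhammer ℝ N).eval (α + 1) * (ascPochhammer ℝ (2 * k)).eval ((N : ℝ) + α + β + 1))) * key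

lemma realRooted_of_complex (m : ℕ) : ∀ q : ℝ[X], q.natDegree = m → q ≠ 0 →
    (∀ z : ℂ, aeval z q = 0 → z.im = 0) → RealRooted q := by
  induction m with
  | zero =>
    intro q hq _ _
    unfold RealRooted
    have := q.card_roots'
    omega
  | succ m ih =>
    intro q hq h0 hz
    obtain ⟨z, hz0⟩ := IsAlgClosed.exists_aeval_eq_zero ℂ q (by
      rw [degree_eq_natDegree h0, hq]; exact_mod_cast Nat.succ_ne_zero m)
    have him := hz z hz0
    have hzr : z = algebraMap ℝ ℂ z.re := by
      apply Complex.ext <;> simp [him]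
    have hr : q.IsRoot z.re := by
      rw [hzr, aeval_algebraMap_apply] at hz0
      simpa using hz0
    obtain ⟨r, hr⟩ := dvd_iff_isRoot.2 hr
    have hr0 : r ≠ 0 := by rintro rfl; simp [hr] at h0
    have hX : (X - C z.re) ≠ (0 : ℝ[X]) := X_sub_C_ne_zero _
    have hdeg : q.natDegree = 1 + r.natDegree := by
      rw [hr, natDegree_mul hX hr0, natDegree_X_sub_C]
    have := ih r (by omega) hr0 (fun w hw => hz w (by rw [hr, map_mul, hw, mul_zero]))
    unfold RealRooted at *
    rw [hdeg, hr, roots_mul (hr ▸ h0), roots_X_sub_C, Multiset.card_add, this]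
    simp

lemma logd (S : Multiset ℝ) (hS : ∀ r ∈ S, r < 0) (z : ℂ) (hz : z.im ≠ 0) :
    aeval z (S.map (fun r => X - C r)).prod ≠ 0 ∧
    ∃ w : ℂ, z * aeval z (derivative (S.map (fun r => X - C r)).prod) =
      w * aeval z (S.map (fun r => X - C r)).prod ∧
      0 ≤ w.im * z.im ∧ (S ≠ 0 → w.im ≠ 0) := by
  induction S using Multiset.induction with
  | empty => exact ⟨by simp, 0, by simp⟩
  | cons r S ih =>
    obtain ⟨h1, w, hw, hw2, -⟩ := ih (fun x hx => hS x (Multiset.mem_cons_of_mem hx))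
    have hr := hS r (Multiset.mem_cons_self r S)
    have hzr : z - (r : ℂ) ≠ 0 := fun h => hz (by simpa using congrArg Complex.im h)
    have him : (z / (z - r)).im * z.im = - r * z.im ^ 2 / Complex.normSq (z - r) := by
      rw [Complex.div_im]; simp; ring
    have hpos : 0 < (z / (z - r)).im * z.im := by
      rw [him]
      have := Complex.normSq_pos.2 hzr
      have : 0 < -r := by linarith
      positivity
    have hpos2 : 0 < (w + z / (z - r)).im * z.im := by
      rw [Complex.add_im, add_mul]; linarith
    simp only [Multiset.map_cons, Multiset.prod_cons]
    refine ⟨?_, w + z / (z - r), ?_, hpos2.le, fun _ h => by rw [h] at hpos2; simp at hpos2⟩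
    · simp only [map_mul, map_sub, aeval_X, aeval_C]
      exact mul_ne_zero hzr h1
    · simp only [derivative_mul, map_mul, map_sub, map_add, aeval_X, aeval_C, derivative_X,
        derivative_C, sub_zero, one_mul, map_one]
      simp only [Complex.coe_algebraMap]
      rw [mul_add, add_mul, mul_left_comm z, hw]
      field_simp
      ring

lemma comb_realRooted (p : ℝ[X]) (hp : RealRooted p) (hneg : ∀ r ∈ p.roots, r < 0)
    (hd : 0 < p.natDegree) (a b : ℝ) : RealRooted (C a * p + C b * (X * derivative p)) := by
  by_cases h0 : C a * p + C b * (X * derivative p) = 0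
  · rw [h0]; simp [RealRooted]
  refine realRooted_of_complex _ _ rfl h0 fun z hz => ?_
  by_contra him
  have hfac := C_leadingCoeff_mul_prod_multiset_X_sub_C hp
  obtain ⟨h1, w, hw, -, hw3⟩ := logd p.roots hneg z him
  have hw3 := hw3 (by intro h; unfold RealRooted at hp; simp [h] at hp; omega)
  set P := (p.roots.map (fun r => X - C r)).prod
  set c := p.leadingCoeff
  have hc : (c : ℂ) ≠ 0 := by
    have : c ≠ 0 := leadingCoeff_ne_zero.2 (by rintro rfl; simp at hd)
    exact_mod_cast this
  rw [← hfac] at hz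
  simp only [derivative_C_mul, map_add, map_mul, aeval_C, aeval_X, Complex.coe_algebraMap] at hz
  have : (c : ℂ) * aeval z P * (a + b * w) = 0 := by
    linear_combination hz - b * c * hw
  have h3 : (a + b * w : ℂ) = 0 := by
    simpa [hc, h1] using this
  have hb : b = 0 := by
    have := congrArg Complex.im h3
    simpa [hw3] using this
  have ha : a = 0 := by
    have := congrArg Complex.re h3
    simpa [hb] using this
  exact h0 (by simp [ha, hb])

lemma deriv_nonneg_aux (S : Multiset ℝ) (x : ℝ) (hS : ∀ r ∈ S, r ≤ x) :
    0 ≤ (S.map (fun r => X - C r)).prod.eval x ∧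
    0 ≤ (derivative (S.map (fun r => X - C r)).prod).eval x := by
  induction S using Multiset.induction with
  | empty => simp
  | cons r S ih =>
    obtain ⟨h1, h2⟩ := ih (fun x hx => hS x (Multiset.mem_cons_of_mem hx))
    have hr := sub_nonneg.2 (hS r (Multiset.mem_cons_self r S))
    simp only [Multiset.map_cons, Multiset.prod_cons, derivative_mul, eval_mul, eval_add, eval_sub,
      eval_X, eval_C, derivative_sub, derivative_X, derivative_C, sub_zero, one_mul]
    exact ⟨mul_nonneg hr h1, add_nonneg h1 (mul_nonneg hr h2)⟩

/-- If `φ_n^{(α,β−1)}` has only real zeros (with `α > −1`, `n+α+β > 0`, `n ≥ 4`), then all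
zeros of `φ_n^{(α,β)}` and `φ_{n−1}^{(α,β)}` are real and negative, the zeros of these two
polynomials interlace non-strictly (they form a real pair), and the zero of `φ_{n−1}^{(α,β)}`
closest to the origin is no closer than that of `φ_n^{(α,β)}`. -/
theorem phi_interlacing_of_shifted_real_rooted (α β : ℝ) (n : ℕ) (hn : 4 ≤ n)
    (hα : -1 < α) (hnab : 0 < (n : ℝ) + α + β)
    (h : RealRooted (phi α (β - 1) n)) :
    RealRooted (phi α β n) ∧ RealRooted (phi α β (n - 1)) ∧
    (∀ x ∈ (phi α β n).roots, x < 0) ∧ (∀ x ∈ (phi α β (n - 1)).roots, x < 0) ∧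
    RealPair (phi α β n) (phi α β (n - 1)) ∧
    maxRoot (phi α β (n - 1)) ≤ maxRoot (phi α β n) := by
  obtain ⟨N, rfl⟩ : ∃ N, n = N + 1 := ⟨n - 1, by omega⟩
  rw [Nat.add_sub_cancel]
  have id1 := phi_id1 α β (N + 1)
  have id2 := phi_id2 α β N hα
  have pp : ∀ x : ℝ, 0 ≤ x → 0 < (phi α (β - 1) (N + 1)).eval x :=
    phi_eval_pos α (β - 1) (N + 1) hα (by linarith)
  have pg : ∀ x : ℝ, 0 ≤ x → 0 < (phi α β (N + 1)).eval x :=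
    phi_eval_pos α β (N + 1) hα (by linarith)
  have ph : ∀ x : ℝ, 0 ≤ x → 0 < (phi α β N).eval x :=
    phi_eval_pos α β N hα (by push_cast at hnab; linarith)
  have hdp : 0 < (phi α (β - 1) (N + 1)).natDegree := by
    refine lt_of_lt_of_le one_pos (le_natDegree_of_ne_zero ?_)
    rw [aux_coeff]
    exact (auxD_pos _ _ _ _ hα (by linarith) (by omega)).ne'
  have hdh : 0 < (phi α β N).natDegree := by
    refine lt_of_lt_of_le one_pos (le_natDegree_of_ne_zero ?_)
    rw [aux_coeff]
    exact (auxD_pos _ _ _ _ hα (by push_cast at hnab; linarith) (by omega)).ne'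
  have hplc : 0 < (phi α (β - 1) (N + 1)).leadingCoeff := by
    refine lt_of_le_of_ne ?_ (leadingCoeff_ne_zero.2 (by intro h0; simp [h0] at hdp)).symm
    rw [leadingCoeff, aux_coeff]
    exact auxD_nonneg _ _ _ _ hα (by linarith)
  set p := phi α (β - 1) (N + 1)
  set g := phi α β (N + 1)
  set q := phi α β N
  set s : ℝ := ((N + 1 : ℕ) : ℝ) + α + β
  have hs : s ≠ 0 := hnab.ne'
  have ht0 : 0 < (N : ℝ) + 1 + α := by
    have : (0 : ℝ) ≤ N := by positivity
    linarith
  set t : ℝ := (N : ℝ) + 1 + α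
  have negOf : ∀ f : ℝ[X], (∀ x : ℝ, 0 ≤ x → 0 < f.eval x) → ∀ x ∈ f.roots, x < 0 := by
    intro f hf x hx
    by_contra hx0
    have := hf x (not_lt.1 hx0)
    rw [(mem_roots'.1 hx).2] at this
    exact lt_irrefl _ this
  have hpneg := negOf p pp
  have hg : g = p + C (2 / s) * (X * derivative p) := by
    have hC : C s⁻¹ * C s = (1 : ℝ[X]) := by rw [← C_mul, inv_mul_cancel₀ hs, C_1]
    have e : C (2 / s) = C s⁻¹ * (C 2 : ℝ[X]) := by rw [← C_mul]; congr 1; ring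
    rw [e]
    linear_combination C s⁻¹ * id1 + (p - g) * hC
  have hq : q = C (((N : ℝ) + 1) / t) * p + C (-2 / t) * (X * derivative p) := by
    have hC : C t⁻¹ * C t = (1 : ℝ[X]) := by rw [← C_mul, inv_mul_cancel₀ ht0.ne', C_1]
    have e : C (-2 / t) = - C t⁻¹ * (C 2 : ℝ[X]) := by rw [← C_neg, ← C_mul]; congr 1; ring
    have e2 : C (((N : ℝ) + 1) / t) = C t⁻¹ * (C ((N : ℝ) + 1) : ℝ[X]) := by
      rw [← C_mul]; congr 1; ring
    rw [e, e2]
    linear_combination C t⁻¹ * id2 - q * hC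
  have pair : RealPair g q := by
    intro a b
    have : C a * g + C b * q = C (a + b * (((N : ℝ) + 1) / t)) * p +
        C (a * (2 / s) + b * (-2 / t)) * (X * derivative p) := by
      rw [hg, hq]; simp only [C_add, C_mul]; ring
    rw [this]
    exact comb_realRooted p h hpneg hdp _ _
  have rg : RealRooted g := by simpa using pair 1 0
  have rq : RealRooted q := by simpa using pair 0 1
  refine ⟨rg, rq, negOf g pg, negOf q ph, pair, ?_⟩
  have hroots : p.roots ≠ 0 := by
    intro h'; unfold RealRooted at h; simp [h'] at h; omega
  have hne : p.roots.toFinset.Nonempty := by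
    rw [Multiset.toFinset_nonempty]; exact hroots
  obtain ⟨x0, hx0, hmax⟩ := Finset.exists_max_image p.roots.toFinset id hne
  simp only [Multiset.mem_toFinset, id] at hx0 hmax
  have hx0neg := hpneg x0 hx0
  have hfac := C_leadingCoeff_mul_prod_multiset_X_sub_C h
  have hder : ∀ x, x0 ≤ x → 0 ≤ p.eval x ∧ 0 ≤ (derivative p).eval x := by
    intro x hx
    obtain ⟨u1, u2⟩ := deriv_nonneg_aux p.roots x (fun r hr => (hmax r hr).trans hx)
    rw [← hfac, derivative_C_mul, eval_C_mul, eval_C_mul]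
    exact ⟨mul_nonneg hplc.le u1, mul_nonneg hplc.le u2⟩
  have hp0 : p ≠ 0 := by intro h0; simp [h0] at hdp
  -- roots of q are at most x0
  have hqle : ∀ x, q.IsRoot x → x ≤ x0 := by
    intro x hx
    by_contra hlt
    rw [not_le] at hlt
    have hxneg : x < 0 := negOf q ph x ((mem_roots (by intro h0; simp [h0] at hdh)).2 hx)
    obtain ⟨u1, u2⟩ := hder x hlt.le
    have u3 : p.eval x ≠ 0 := fun h0 => absurd (hmax x ((mem_roots hp0).2 h0)) (not_le.2 hlt)
    have u4 : 0 < p.eval x := lt_of_le_of_ne u1 u3.symm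
    have := congrArg (eval x) id2
    simp only [eval_mul, eval_sub, eval_C, eval_X] at this
    rw [hx.eq_zero, mul_zero] at this
    have u5 : 0 ≤ (-x) * (derivative p).eval x := mul_nonneg (by linarith) u2
    have u6 : 0 < ((N : ℝ) + 1) * p.eval x := by positivity
    linarith
  -- g has a root in [x0, 0]
  have hgx0 : g.eval x0 ≤ 0 := by
    rw [hg]
    simp only [eval_add, eval_mul, eval_C, eval_X]
    rw [(mem_roots'.1 hx0).2]
    obtain ⟨u1, u2⟩ := hder x0 le_rfl
    have : 0 ≤ 2 / s * ((-x0) * (derivative p).eval x0) :=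
      mul_nonneg (by have : 0 < s := hnab; positivity) (mul_nonneg (by linarith) u2)
    linarith
  obtain ⟨y, ⟨hy1, hy2⟩, hy⟩ : ∃ y ∈ Set.Icc x0 0, g.eval y = 0 := by
    have := intermediate_value_Icc hx0neg.le (f := fun x => g.eval x) g.continuous.continuousOn
    exact this ⟨hgx0, (pg 0 le_rfl).le⟩
  have hg0 : g ≠ 0 := by
    intro h0; have := pg 0 le_rfl; simp [h0] at this
  have hbdd : BddAbove {x : ℝ | g.IsRoot x} :=
    ⟨0, fun x hx => (negOf g pg x ((mem_roots hg0).2 hx)).le⟩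
  have hqr : {x : ℝ | q.IsRoot x}.Nonempty := by
    have : q.roots ≠ 0 := by
      intro h'; unfold RealRooted at rq; simp [h'] at rq; omega
    obtain ⟨x, hx⟩ := Multiset.exists_mem_of_ne_zero this
    exact ⟨x, (mem_roots'.1 hx).2⟩
  calc maxRoot q ≤ x0 := csSup_le hqr hqle
    _ ≤ y := hy1
    _ ≤ maxRoot g := le_csSup hbdd hy
end

section
/- Fix n ≥ 4, −1 < α < 1, β > 0, A > 0, and let f(x;μ) := Σ_{k=0}^n μ^k [A·(d/dx)^k P_n^{(α,β)}(x) + μ·(d/dx)^k P_{n−1}^{(α,β)}(x)]. Then the polynomial μ ↦ f(1;μ) is Hurwitz stable: every complex zero μ of f(1;·) satisfies Re μ < 0. -/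
open Polynomial

noncomputable def jd (α β : ℝ) (n k : ℕ) : ℝ :=
  (ascPochhammer ℝ n).eval (α + 1) / (n.factorial : ℝ) *
    ((ascPochhammer ℝ k).eval (-(n : ℝ)) * (ascPochhammer ℝ k).eval ((n : ℝ) + α + β + 1) /
          ((k.factorial : ℝ) * (ascPochhammer ℝ k).eval (α + 1))) * (1 / 2) ^ k

theorem jacobiP_eq (α β : ℝ) (n : ℕ) :
    jacobiP α β n = ∑ k ∈ Finset.range (n + 1), C (jd α β n k) * (1 - X) ^ k := by
  unfold jacobiP jd
  rw [Finset.mul_sum]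
  refine Finset.sum_congr rfl fun k _ => ?_
  rw [mul_pow, C_mul, C_mul, C_pow]
  ring

theorem jd_succ (α β : ℝ) (n k : ℕ) (hα : -1 < α) :
    2 * (k + 1) * (k + 1 + α) * jd α β n (k + 1) =
      ((k : ℝ) - n) * (k + n + (α + β + 1)) * jd α β n k := by
  unfold jd
  have h1 : (ascPochhammer ℝ k).eval (α + 1) ≠ 0 := (ascPochhammer_pos k _ (by linarith)).ne'
  have h2 : (k : ℝ) + 1 + α ≠ 0 := by
    have : (0 : ℝ) ≤ k := by positivity
    linarith
  have h3 : (k.factorial : ℝ) ≠ 0 := by positivity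
  have h4 : (n.factorial : ℝ) ≠ 0 := by positivity
  have h5 : α + 1 + k ≠ 0 := by intro h; apply h2; linarith
  have h6 : (k : ℝ) + 1 ≠ 0 := by positivity
  simp only [ascPochhammer_succ_eval, Nat.factorial_succ, Nat.cast_mul, Nat.cast_add, Nat.cast_one]
  field_simp
  ring

theorem jd_last (α β : ℝ) (n : ℕ) : jd α β n (n + 1) = 0 := by
  unfold jd
  rw [ascPochhammer_eval_neg_coe_nat_of_lt (Nat.lt_succ_self n)]
  simp

theorem jacobiP_eval_one_pos (α β : ℝ) (n : ℕ) (hα : -1 < α) : 0 < (jacobiP α β n).eval 1 := by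
  have h1 : 0 < (ascPochhammer ℝ n).eval (α + 1) := ascPochhammer_pos n _ (by linarith)
  rw [jacobiP_eq, eval_finsetSum, Finset.sum_eq_single 0]
  · simp [jd]; positivity
  · intro b _ hb; simp [hb]
  · simp

theorem coeff_one_sub_X_pow (n : ℕ) : ((1 - X : ℝ[X]) ^ n).coeff n = (-1) ^ n := by
  have hd : (1 - X : ℝ[X]).natDegree ≤ 1 := by compute_degree
  have := coeff_pow_of_natDegree_le (m := n) hd
  rw [mul_one] at this
  rw [this]
  simp [coeff_one]

theorem natDegree_one_sub_X_pow (n : ℕ) : ((1 - X : ℝ[X]) ^ n).natDegree ≤ n := by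
  have hd : (1 - X : ℝ[X]).natDegree ≤ 1 := by compute_degree
  simpa using natDegree_pow_le_of_le n hd

theorem jacobiP_coeff_gt (α β : ℝ) (n m : ℕ) (h : n < m) : (jacobiP α β n).coeff m = 0 := by
  rw [jacobiP_eq, finsetSum_coeff]
  refine Finset.sum_eq_zero fun k hk => ?_
  rw [coeff_C_mul, coeff_eq_zero_of_natDegree_lt, mul_zero]
  have := natDegree_one_sub_X_pow k
  have := Finset.mem_range.1 hk
  omega

theorem jd_sign (α β : ℝ) (n k : ℕ) (hα : -1 < α) (hs : 0 < α + β + 1) (hk : k ≤ n) :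
    0 < (-1) ^ k * jd α β n k := by
  induction k with
  | zero =>
    have h1 : 0 < (ascPochhammer ℝ n).eval (α + 1) := ascPochhammer_pos n _ (by linarith)
    simp [jd]; positivity
  | succ k ih =>
    have ih := ih (by omega)
    have h := jd_succ α β n k hα
    have hkn : (0 : ℝ) < (n : ℝ) - k := by
      have : (k : ℝ) + 1 ≤ n := by exact_mod_cast hk
      linarith
    have hk0 : (0 : ℝ) ≤ k := by positivity
    have hp : 0 < 2 * ((k : ℝ) + 1) * (k + 1 + α) := by
      have : 0 < (k : ℝ) + 1 + α := by linarith
      positivity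
    have e : 2 * ((k : ℝ) + 1) * (k + 1 + α) * ((-1) ^ (k + 1) * jd α β n (k + 1)) =
        (n - k) * (k + n + (α + β + 1)) * ((-1) ^ k * jd α β n k) := by
      rw [pow_succ]
      linear_combination (-(-1) ^ k) * h
    have : 0 < 2 * ((k : ℝ) + 1) * (k + 1 + α) * ((-1) ^ (k + 1) * jd α β n (k + 1)) := by
      rw [e]
      positivity
    exact pos_of_mul_pos_right this hp.le

theorem jacobiP_coeff_pos (α β : ℝ) (n : ℕ) (hα : -1 < α) (hs : 0 < α + β + 1) :
    0 < (jacobiP α β n).coeff n := by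
  rw [jacobiP_eq, finsetSum_coeff, Finset.sum_range_succ, Finset.sum_eq_zero, zero_add, coeff_C_mul,
    coeff_one_sub_X_pow, mul_comm]
  · exact jd_sign α β n n hα hs le_rfl
  · intro k hk
    rw [coeff_C_mul, coeff_eq_zero_of_natDegree_lt, mul_zero]
    have := natDegree_one_sub_X_pow k
    have := Finset.mem_range.1 hk
    omega

/-- The Jacobi differential operator. -/
noncomputable def jop (α β : ℝ) (p : ℝ[X]) : ℝ[X] :=
  (1 - X ^ 2) * derivative (derivative p) + (C (β - α) - C (α + β + 2) * X) * derivative p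

theorem jop_add (α β : ℝ) (p q : ℝ[X]) : jop α β (p + q) = jop α β p + jop α β q := by
  unfold jop; simp only [derivative_add]; ring

theorem jop_C_mul (α β c : ℝ) (p : ℝ[X]) : jop α β (C c * p) = C c * jop α β p := by
  unfold jop; simp only [derivative_C_mul]; ring

theorem jop_sum (α β : ℝ) (s : Finset ℕ) (g : ℕ → ℝ[X]) :
    jop α β (∑ k ∈ s, g k) = ∑ k ∈ s, jop α β (g k) := by
  unfold jop; simp only [derivative_sum, Finset.mul_sum, Finset.sum_add_distrib]

theorem jop_pow_zero (α β : ℝ) : jop α β ((1 - X) ^ 0) = 0 := by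
  simp [jop]

theorem jop_pow_succ (α β : ℝ) (k : ℕ) :
    jop α β ((1 - X) ^ (k + 1)) = C (2 * ((k : ℝ) + 1) * (k + 1 + α)) * (1 - X) ^ k
      - C (((k : ℝ) + 1) * (k + 1 + (α + β + 1))) * (1 - X) ^ (k + 1) := by
  cases k with
  | zero =>
    have h2 : (C 2 : ℝ[X]) = 2 := map_ofNat C 2
    unfold jop
    simp [h2]
    ring
  | succ k =>
    unfold jop
    simp only [derivative_pow, derivative_mul, derivative_sub, derivative_one, derivative_X,
      Nat.add_sub_cancel, derivative_C, C_add, C_mul, C_sub, Nat.cast_add, Nat.cast_one, map_natCast, C_1,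
      derivative_natCast, map_ofNat, derivative_zero, derivative_add]
    ring

theorem jop_jacobiP (α β : ℝ) (n : ℕ) (hα : -1 < α) :
    jop α β (jacobiP α β n) = C (-((n : ℝ) * (n + (α + β + 1)))) * jacobiP α β n := by
  rw [jacobiP_eq, jop_sum, Finset.sum_range_succ']
  simp only [jop_C_mul, jop_pow_zero, jop_pow_succ, mul_zero, add_zero]
  simp only [mul_sub, Finset.sum_sub_distrib]
  have e1 : ∑ k ∈ Finset.range n, C (jd α β n (k + 1)) * (C (2 * ((k : ℝ) + 1) * (k + 1 + α)) * (1 - X) ^ k)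
      = ∑ k ∈ Finset.range (n + 1), C (((k : ℝ) - n) * (k + n + (α + β + 1)) * jd α β n k) * (1 - X) ^ k := by
    rw [Finset.sum_range_succ]
    simp only [sub_self, zero_mul, C_0, add_zero]
    refine Finset.sum_congr rfl fun k _ => ?_
    rw [← jd_succ α β n k hα, ← mul_assoc, ← C_mul, mul_comm (jd α β n (k + 1))]
  have e2 : ∑ k ∈ Finset.range n, C (jd α β n (k + 1)) *
      (C (((k : ℝ) + 1) * (k + 1 + (α + β + 1))) * (1 - X) ^ (k + 1))
      = ∑ k ∈ Finset.range (n + 1), C ((k : ℝ) * (k + (α + β + 1)) * jd α β n k) * (1 - X) ^ k := by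
    rw [Finset.sum_range_succ']
    simp only [Nat.cast_zero, zero_mul, C_0, add_zero]
    refine Finset.sum_congr rfl fun k _ => ?_
    rw [← mul_assoc, ← C_mul, mul_comm (jd α β n (k + 1))]
    push_cast
    rfl
  rw [e1, e2, ← Finset.sum_sub_distrib, Finset.mul_sum]
  refine Finset.sum_congr rfl fun k _ => ?_
  rw [← sub_mul, ← C_sub, ← mul_assoc, ← C_mul]
  congr 2
  ring

theorem jop_symm (α β : ℝ) (M : ℝ[X] →ₗ[ℝ] ℝ)
    (hM : ∀ r : ℝ[X], M ((1 - X ^ 2) * derivative r + (C β * (1 - X) - C (α + 1) * (1 + X)) * r) = 0)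
    (p q : ℝ[X]) : M ((1 + X) * (q * jop α β p)) = M ((1 + X) * (p * jop α β q)) := by
  rw [← sub_eq_zero, ← map_sub, ← hM ((1 + X) * (derivative p * q - p * derivative q))]
  congr 1
  unfold jop
  simp only [derivative_mul, derivative_add, derivative_sub, derivative_one, derivative_X, C_add, C_sub, C_1, map_ofNat]
  ring

theorem M_C_mul (M : ℝ[X] →ₗ[ℝ] ℝ) (c : ℝ) (q : ℝ[X]) : M (C c * q) = c * M q := by
  rw [← smul_eq_C_mul, map_smul, smul_eq_mul]

theorem orth_pow (α β : ℝ) (hα : -1 < α) (hs : 0 < α + β + 1) (M : ℝ[X] →ₗ[ℝ] ℝ)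
    (hM : ∀ r : ℝ[X], M ((1 - X ^ 2) * derivative r + (C β * (1 - X) - C (α + 1) * (1 + X)) * r) = 0)
    (n j : ℕ) (hj : j < n) : M ((1 + X) * (jacobiP α β n * (1 - X) ^ j)) = 0 := by
  induction j with
  | zero =>
    have h := jop_symm α β M hM (jacobiP α β n) ((1 - X) ^ 0)
    rw [jop_jacobiP α β n hα, jop_pow_zero, mul_zero, mul_zero, map_zero,
      show (1 + X) * ((1 - X) ^ 0 * (C (-((n : ℝ) * (n + (α + β + 1)))) * jacobiP α β n)) =
        C (-((n : ℝ) * (n + (α + β + 1)))) * ((1 + X) * (jacobiP α β n * (1 - X) ^ 0)) by ring, M_C_mul] at h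
    have hn : (0 : ℝ) < n := by exact_mod_cast hj
    have : (n : ℝ) * (n + (α + β + 1)) ≠ 0 := by positivity
    rcases mul_eq_zero.1 h with h | h
    · exact absurd (neg_eq_zero.1 h) this
    · exact h
  | succ j ih =>
    have ih := ih (by omega)
    have h := jop_symm α β M hM (jacobiP α β n) ((1 - X) ^ (j + 1))
    rw [jop_jacobiP α β n hα, jop_pow_succ,
      show (1 + X) * ((1 - X) ^ (j + 1) * (C (-((n : ℝ) * (n + (α + β + 1)))) * jacobiP α β n)) =
        C (-((n : ℝ) * (n + (α + β + 1)))) * ((1 + X) * (jacobiP α β n * (1 - X) ^ (j + 1))) by ring,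
      show (1 + X) * (jacobiP α β n * (C (2 * ((j : ℝ) + 1) * (j + 1 + α)) * (1 - X) ^ j
          - C (((j : ℝ) + 1) * (j + 1 + (α + β + 1))) * (1 - X) ^ (j + 1))) =
        C (2 * ((j : ℝ) + 1) * (j + 1 + α)) * ((1 + X) * (jacobiP α β n * (1 - X) ^ j))
          - C (((j : ℝ) + 1) * (j + 1 + (α + β + 1))) * ((1 + X) * (jacobiP α β n * (1 - X) ^ (j + 1))) by ring,
      map_sub, M_C_mul, M_C_mul, M_C_mul, ih] at h
    have hjn : (0 : ℝ) < n - (j + 1) := by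
      have : (j : ℝ) + 1 < n := by exact_mod_cast hj
      linarith
    have hne : ((n : ℝ) - (j + 1)) * (n + (j + 1) + (α + β + 1)) ≠ 0 := by positivity
    refine (mul_eq_zero.1 (?_ : ((n : ℝ) - (j + 1)) * (n + (j + 1) + (α + β + 1)) * _ = 0)).resolve_left hne
    linear_combination -h

theorem orth (α β : ℝ) (hα : -1 < α) (hs : 0 < α + β + 1) (M : ℝ[X] →ₗ[ℝ] ℝ)
    (hM : ∀ r : ℝ[X], M ((1 - X ^ 2) * derivative r + (C β * (1 - X) - C (α + 1) * (1 + X)) * r) = 0)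
    (n : ℕ) (q : ℝ[X]) (hq : ∀ m, n ≤ m → q.coeff m = 0) :
    M ((1 + X) * (jacobiP α β n * q)) = 0 := by
  rcases eq_or_ne q 0 with rfl | hq0
  · simp
  have hdeg : q.natDegree < n := by
    by_contra! h
    exact hq0 (leadingCoeff_eq_zero.1 (hq _ h))
  have hd : (1 - X : ℝ[X]).natDegree ≤ 1 := by compute_degree
  have e : q = (q.comp (1 - X)).comp (1 - X) := by
    rw [comp_assoc]; simp
  have hdeg2 : (q.comp (1 - X)).natDegree < n := by
    refine lt_of_le_of_lt natDegree_comp_le ?_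
    nlinarith
  rw [e, comp_eq_sum_left, sum_over_range' _ (by simp) n hdeg2, Finset.mul_sum, Finset.mul_sum, map_sum]
  refine Finset.sum_eq_zero fun j hj => ?_
  rw [show ∀ c : ℝ, (1 + X) * (jacobiP α β n * (C c * (1 - X) ^ j)) =
    C c * ((1 + X) * (jacobiP α β n * (1 - X) ^ j)) by intro c; ring, M_C_mul,
    orth_pow α β hα hs M hM n j (Finset.mem_range.1 hj), mul_zero]

theorem weight_integrable (α β : ℝ) (hα : -1 < α) (hβ : 0 < β) :
    IntervalIntegrable (fun x : ℝ => (1 - x) ^ α * (1 + x) ^ (β - 1)) MeasureTheory.volume (-1) 1 := by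
  have h1 : IntervalIntegrable (fun x : ℝ => (1 + x) ^ (β - 1)) MeasureTheory.volume (-1) 0 := by
    have := (intervalIntegral.intervalIntegrable_rpow' (a := 0) (b := 1) (r := β - 1) (by linarith)).comp_add_left 1
    simpa using this
  have h2 : IntervalIntegrable (fun x : ℝ => (1 - x) ^ α) MeasureTheory.volume 0 1 := by
    have := (intervalIntegral.intervalIntegrable_rpow' (a := 1) (b := 0) (r := α) hα).comp_sub_left 1
    simpa using this
  refine IntervalIntegrable.trans (b := 0) ?_ ?_
  · refine h1.continuousOn_mul ?_
    rw [Set.uIcc_of_le (by norm_num)]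
    refine ContinuousOn.rpow_const (by fun_prop) ?_
    intro x hx
    left
    have := hx.2
    linarith
  · refine h2.mul_continuousOn ?_
    rw [Set.uIcc_of_le (by norm_num)]
    refine ContinuousOn.rpow_const (by fun_prop) ?_
    intro x hx
    left
    have := hx.1
    linarith

theorem weight_poly_integrable (α β : ℝ) (hα : -1 < α) (hβ : 0 < β) (q : ℝ[X]) :
    IntervalIntegrable (fun x : ℝ => (1 - x) ^ α * (1 + x) ^ (β - 1) * q.eval x)
      MeasureTheory.volume (-1) 1 :=
  (weight_integrable α β hα hβ).mul_continuousOn q.continuous.continuousOn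

theorem exists_functional (α β : ℝ) (hα : -1 < α) (hβ : 0 < β) :
    ∃ M : ℝ[X] →ₗ[ℝ] ℝ,
      (∀ r : ℝ[X], M ((1 - X ^ 2) * derivative r + (C β * (1 - X) - C (α + 1) * (1 + X)) * r) = 0) ∧
      (∀ q : ℝ[X], q ≠ 0 → (∀ x ∈ Set.Ioo (-1 : ℝ) 1, 0 ≤ q.eval x) → 0 < M q) := by
  refine ⟨{ toFun := fun q => ∫ x in (-1 : ℝ)..1, (1 - x) ^ α * (1 + x) ^ (β - 1) * q.eval x
            map_add' := ?_
            map_smul' := ?_ }, ?_, ?_⟩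
  · intro p q
    rw [← intervalIntegral.integral_add (weight_poly_integrable α β hα hβ p)
      (weight_poly_integrable α β hα hβ q)]
    simp only [eval_add, mul_add]
  · intro c q
    simp only [RingHom.id_apply, smul_eq_mul, eval_smul]
    rw [← intervalIntegral.integral_const_mul]
    congr 1
    ext x
    ring
  · intro r
    simp only [LinearMap.coe_mk, AddHom.coe_mk]
    have key := intervalIntegral.integral_eq_sub_of_hasDerivAt_of_le (a := -1) (b := 1)
      (f := fun x : ℝ => (1 - x) ^ (α + 1) * (1 + x) ^ β * r.eval x)
      (f' := fun x : ℝ => (1 - x) ^ α * (1 + x) ^ (β - 1) *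
        ((1 - X ^ 2) * derivative r + (C β * (1 - X) - C (α + 1) * (1 + X)) * r).eval x)
      (by norm_num) ?_ ?_ (weight_poly_integrable α β hα hβ _)
    · rw [key]
      norm_num [Real.zero_rpow (show α + 1 ≠ 0 by linarith), Real.zero_rpow hβ.ne']
    · refine ContinuousOn.mul (ContinuousOn.mul ?_ ?_) r.continuous.continuousOn
      · exact ContinuousOn.rpow_const (by fun_prop) (fun x hx => Or.inr (by linarith))
      · exact ContinuousOn.rpow_const (by fun_prop) (fun x hx => Or.inr hβ.le)
    · intro x hx
      have p1 : 0 < 1 - x := by linarith [hx.2]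
      have p2 : 0 < 1 + x := by linarith [hx.1]
      have d1 : HasDerivAt (fun x : ℝ => (1 - x) ^ (α + 1)) (-1 * (α + 1) * (1 - x) ^ (α + 1 - 1)) x :=
        ((hasDerivAt_id x).const_sub 1).rpow_const (Or.inl p1.ne')
      have d2 : HasDerivAt (fun x : ℝ => (1 + x) ^ β) (1 * β * (1 + x) ^ (β - 1)) x :=
        ((hasDerivAt_id x).const_add 1).rpow_const (Or.inl p2.ne')
      refine ((d1.mul d2).mul (r.hasDerivAt x)).congr_deriv ?_
      have e1 : (1 - x) ^ (α + 1) = (1 - x) ^ α * (1 - x) := by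
        rw [Real.rpow_add p1, Real.rpow_one]
      have e2 : (1 + x) ^ β = (1 + x) ^ (β - 1) * (1 + x) := by
        rw [← Real.rpow_add_one p2.ne']; simp
      simp only [Pi.mul_apply]
      rw [e1, e2, add_sub_cancel_right]
      simp
      ring
  · intro q hq hpos
    simp only [LinearMap.coe_mk, AddHom.coe_mk]
    have hae : 0 ≤ᵐ[MeasureTheory.volume.restrict (Set.Ioc (-1 : ℝ) 1)]
        (fun x : ℝ => (1 - x) ^ α * (1 + x) ^ (β - 1) * q.eval x) := by
      rw [← MeasureTheory.restrict_Ioo_eq_restrict_Ioc]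
      filter_upwards [MeasureTheory.ae_restrict_mem measurableSet_Ioo] with x hx
      have p1 : 0 < 1 - x := by linarith [hx.2]
      have p2 : 0 < 1 + x := by linarith [hx.1]
      have := hpos x hx
      simp only [Pi.zero_apply]
      positivity
    rw [intervalIntegral.integral_pos_iff_support_of_nonneg_ae' (by rwa [Set.uIoc_of_le (by norm_num)]) (weight_poly_integrable α β hα hβ q)]
    refine ⟨by norm_num, ?_⟩
    have hsub : Set.Ioo (-1 : ℝ) 1 \ (q.roots.toFinset : Set ℝ) ⊆
        Function.support (fun x : ℝ => (1 - x) ^ α * (1 + x) ^ (β - 1) * q.eval x) ∩ Set.Ioc (-1) 1 := by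
      intro x hx
      have hx1 := hx.1
      have p1 : 0 < 1 - x := by linarith [hx1.2]
      have p2 : 0 < 1 + x := by linarith [hx1.1]
      have h0 : q.eval x ≠ 0 := by
        intro h
        apply hx.2
        simp [hq, h]
      refine ⟨?_, hx1.1, hx1.2.le⟩
      simp only [Function.mem_support]
      positivity
    refine lt_of_lt_of_le ?_ (MeasureTheory.measure_mono hsub)
    rw [MeasureTheory.measure_sdiff_null ((Finset.finite_toSet _).measure_zero _)]
    simp

/-- The key energy argument, for the real and imaginary parts `u`, `v` of `f(x; a + i b)`. -/
theorem energy (α β A a b : ℝ) (n : ℕ)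
    (hα1 : -1 < α) (hα2 : α < 1) (hβ : 0 < β) (hA : 0 < A) (u v : ℝ[X])
    (hu : C a * derivative u - C b * derivative v + C A * jacobiP α β (n + 1) + C a * jacobiP α β n = u)
    (hv : C b * derivative u + C a * derivative v + C b * jacobiP α β n = v)
    (hud : ∀ m, n + 1 < m → u.coeff m = 0) (hvd : ∀ m, n + 1 < m → v.coeff m = 0)
    (hu1 : u.eval 1 = 0) (hv1 : v.eval 1 = 0) : a < 0 := by
  have hs : 0 < α + β + 1 := by linarith
  obtain ⟨M, hM, hpos⟩ := exists_functional α β hα1 hβ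
  have hN : 0 < a ^ 2 + b ^ 2 := by
    by_contra! h
    have ha : a = 0 := by nlinarith
    have hb : b = 0 := by nlinarith
    subst ha hb
    have h1 := jacobiP_eval_one_pos α β (n + 1) hα1
    have := congrArg (eval 1) hu
    simp [hu1] at this
    rcases this with h | h <;> linarith
  have lc1 := jacobiP_coeff_pos α β (n + 1) hα1 hs
  have lc0 := jacobiP_coeff_pos α β n hα1 hs
  have cu : u.coeff (n + 1) = A * (jacobiP α β (n + 1)).coeff (n + 1) := by
    have := congrArg (fun p => p.coeff (n + 1)) hu
    simp only [coeff_add, coeff_sub, coeff_C_mul, coeff_derivative, hud (n + 1 + 1) (by omega),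
      hvd (n + 1 + 1) (by omega), jacobiP_coeff_gt α β n (n + 1) (by omega)] at this
    linarith
  obtain ⟨U', hU'⟩ := dvd_iff_isRoot.2 hu1
  obtain ⟨V', hV'⟩ := dvd_iff_isRoot.2 hv1
  obtain ⟨U, hU⟩ : ∃ U, u = (1 - X) * U := ⟨-U', by rw [hU', C_1]; ring⟩
  obtain ⟨V, hV⟩ : ∃ V, v = (1 - X) * V := ⟨-V', by rw [hV', C_1]; ring⟩
  have degq : ∀ p q : ℝ[X], p = (1 - X) * q → (∀ m, n + 1 < m → p.coeff m = 0) →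
      (∀ m, n < m → q.coeff m = 0) ∧ q.coeff n = - p.coeff (n + 1) := by
    intro p q hpq hp
    have hrec : ∀ m, p.coeff (m + 1) = q.coeff (m + 1) - q.coeff m := by
      intro m
      rw [hpq, sub_mul, one_mul, coeff_sub, coeff_X_mul]
    have hz : ∀ m, n < m → q.coeff m = 0 := by
      have hc : ∀ m, n < m → ∀ d, q.coeff (m + d) = q.coeff m := by
        intro m hm d
        induction d with
        | zero => rfl
        | succ d ih =>
          have h := hrec (m + d)
          rw [hp _ (by omega)] at h
          rw [← ih, ← add_assoc]
          linarith
      intro m hm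
      rw [← hc m hm (q.natDegree + 1)]
      exact coeff_eq_zero_of_natDegree_lt (by omega)
    refine ⟨hz, ?_⟩
    rw [hrec n, hz _ (Nat.lt_succ_self n)]
    ring
  obtain ⟨dU, cU⟩ := degq u U hU hud
  obtain ⟨dV, -⟩ := degq v V hV hvd
  have o1 : M ((1 + X) * (jacobiP α β (n + 1) * U)) = 0 :=
    orth α β hα1 hs M hM (n + 1) U (fun m hm => dU m hm)
  have o2 : M ((1 + X) * (jacobiP α β (n + 1) * V)) = 0 :=
    orth α β hα1 hs M hM (n + 1) V (fun m hm => dV m hm)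
  have hP0 : jacobiP α β n ≠ 0 := by
    intro h; rw [h] at lc0; simp at lc0
  have hX : (1 + X : ℝ[X]) ≠ 0 := by
    intro h
    have := congrArg (eval 0) h
    simp at this
  have hX' : (1 - X : ℝ[X]) ≠ 0 := by
    intro h
    have := congrArg (eval 0) h
    simp at this
  obtain ⟨c, hc⟩ : ∃ c, c = - (A * (jacobiP α β (n + 1)).coeff (n + 1)) / (jacobiP α β n).coeff n := ⟨_, rfl⟩
  have hcneg : c < 0 := by
    rw [hc]
    exact div_neg_of_neg_of_pos (by nlinarith [mul_pos hA lc1]) lc0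
  have o3 : M ((1 + X) * (jacobiP α β n * (U - C c * jacobiP α β n))) = 0 := by
    refine orth α β hα1 hs M hM n _ (fun m hm => ?_)
    rw [coeff_sub, coeff_C_mul]
    rcases hm.lt_or_eq with h | rfl
    · rw [dU m h, jacobiP_coeff_gt α β n m h]; ring
    · rw [cU, cu, hc]; field_simp; ring
  have hsq : 0 < M ((1 + X) * (jacobiP α β n * jacobiP α β n)) := by
    refine hpos _ (mul_ne_zero hX (mul_ne_zero hP0 hP0)) (fun x hx => ?_)
    have : 0 < 1 + x := by linarith [hx.1]
    simp only [eval_mul, eval_add, eval_one, eval_X]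
    exact mul_nonneg this.le (mul_self_nonneg _)
  have o4 : M ((1 + X) * (jacobiP α β n * U)) < 0 := by
    have e : (1 + X) * (jacobiP α β n * U) = (1 + X) * (jacobiP α β n * (U - C c * jacobiP α β n))
      + C c * ((1 + X) * (jacobiP α β n * jacobiP α β n)) := by ring
    rw [e, map_add, o3, M_C_mul, zero_add]
    exact mul_neg_of_neg_of_pos hcneg hsq
  have nonneg : ∀ q : ℝ[X], (∀ x ∈ Set.Ioo (-1 : ℝ) 1, 0 ≤ q.eval x) → 0 ≤ M q := by
    intro q hq
    rcases eq_or_ne q 0 with rfl | h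
    · simp
    · exact (hpos q h hq).le
  have hE : 0 ≤ M ((C (1 - α) * (1 + X) + C β * (1 - X)) * (U ^ 2 + V ^ 2)) := by
    refine nonneg _ (fun x hx => ?_)
    have h1 : 0 < 1 + x := by linarith [hx.1]
    have h2 : 0 < 1 - x := by linarith [hx.2]
    have h3 : 0 < 1 - α := by linarith
    simp only [eval_mul, eval_add, eval_one, eval_X, eval_sub, eval_C, eval_pow]
    positivity
  have hY : 0 ≤ M ((1 + X) * ((1 - X) * (U ^ 2 + V ^ 2))) := by
    refine nonneg _ (fun x hx => ?_)
    have h1 : 0 < 1 + x := by linarith [hx.1]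
    have h2 : 0 < 1 - x := by linarith [hx.2]
    simp only [eval_mul, eval_add, eval_one, eval_X, eval_sub, eval_pow]
    positivity
  have hK := hM (U ^ 2 + V ^ 2)
  -- energy identity
  have hI : C (2 * (a ^ 2 + b ^ 2)) * ((1 + X) * (derivative u * U + derivative v * V)) =
      C (a ^ 2 + b ^ 2) * ((1 - X ^ 2) * derivative (U ^ 2 + V ^ 2) +
        (C β * (1 - X) - C (α + 1) * (1 + X)) * (U ^ 2 + V ^ 2)) -
      C (a ^ 2 + b ^ 2) * ((C (1 - α) * (1 + X) + C β * (1 - X)) * (U ^ 2 + V ^ 2)) := by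
    rw [hU, hV]
    simp only [derivative_mul, derivative_sub, derivative_one, derivative_X, derivative_add,
      derivative_pow, C_add, C_sub, C_mul, C_pow, C_1, map_ofNat, Nat.cast_ofNat, pow_one, Nat.add_one_sub_one]
    ring
  have hJ : C (a ^ 2 + b ^ 2) * ((1 + X) * (derivative u * U + derivative v * V))
      + C (a * A) * ((1 + X) * (jacobiP α β (n + 1) * U))
      - C (b * A) * ((1 + X) * (jacobiP α β (n + 1) * V))
      + C (a ^ 2 + b ^ 2) * ((1 + X) * (jacobiP α β n * U))
      = C a * ((1 + X) * ((1 - X) * (U ^ 2 + V ^ 2))) := by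
    simp only [C_add, C_mul, C_pow]
    have hu2 := hu.trans hU
    have hv2 := hv.trans hV
    linear_combination (1 + X) * (C a * U - C b * V) * hu2 + (1 + X) * (C b * U + C a * V) * hv2
  have hI' := congrArg M hI
  have hJ' := congrArg M hJ
  simp only [map_add M, map_sub M, M_C_mul] at hI' hJ'
  rw [o1, o2] at hJ'
  simp only [← map_add M, ← map_sub M] at hI' hJ'
  rw [hK] at hI'
  by_contra! ha
  have t1 := mul_nonneg ha hY
  have t2 := mul_nonneg hN.le hE
  have t3 := mul_neg_of_pos_of_neg hN o4
  linarith

theorem jacobiP_iterate_derivative (α β : ℝ) (n k : ℕ) (h : n < k) :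
    derivative^[k] (jacobiP α β n) = 0 := by
  refine iterate_derivative_eq_zero (lt_of_le_of_lt ?_ h)
  exact natDegree_le_iff_coeff_eq_zero.2 (fun m hm => jacobiP_coeff_gt α β n m hm)

theorem iterate_coeff_zero (p : ℝ[X]) (N : ℕ) (hp : ∀ m, N < m → p.coeff m = 0) (k m : ℕ) (h : N < m) :
    (derivative^[k] p).coeff m = 0 := by
  rw [coeff_iterate_derivative, hp _ (by omega)]
  simp

/-- `k`-th term of (the real or imaginary part of) the sum defining `f`. -/
noncomputable def gterm (α β A : ℝ) (n : ℕ) (r : ℕ → ℝ) (k : ℕ) : ℝ[X] :=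
  C (A * r k) * derivative^[k] (jacobiP α β (n + 1)) + C (r (k + 1)) * derivative^[k] (jacobiP α β n)

theorem gterm_coeff (α β A : ℝ) (n : ℕ) (r : ℕ → ℝ) (m : ℕ) (h : n + 1 < m) :
    (∑ k ∈ Finset.range (n + 2), gterm α β A n r k).coeff m = 0 := by
  rw [finsetSum_coeff]
  refine Finset.sum_eq_zero fun k _ => ?_
  unfold gterm
  rw [coeff_add, coeff_C_mul, coeff_C_mul,
    iterate_coeff_zero _ (n + 1) (fun m hm => jacobiP_coeff_gt α β (n + 1) m hm) k m h,
    iterate_coeff_zero _ n (fun m hm => jacobiP_coeff_gt α β n m hm) k m (by omega)]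
  ring

theorem gterm_ode (α β A a b : ℝ) (n : ℕ) (r s q : ℕ → ℝ)
    (h : ∀ k, q (k + 1) = a * r k + b * s k) :
    C a * derivative (∑ k ∈ Finset.range (n + 2), gterm α β A n r k) +
      C b * derivative (∑ k ∈ Finset.range (n + 2), gterm α β A n s k) + gterm α β A n q 0 =
      ∑ k ∈ Finset.range (n + 2), gterm α β A n q k := by
  have hlast : gterm α β A n q (n + 2) = 0 := by
    unfold gterm
    rw [jacobiP_iterate_derivative _ _ _ _ (by omega), jacobiP_iterate_derivative _ _ _ _ (by omega)]
    simp
  rw [← add_zero (∑ k ∈ Finset.range (n + 2), gterm α β A n q k), ← hlast,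
    ← Finset.sum_range_succ, Finset.sum_range_succ' (gterm α β A n q) (n + 2), derivative_sum, derivative_sum,
    Finset.mul_sum, Finset.mul_sum, ← Finset.sum_add_distrib]
  rw [add_left_inj]
  refine Finset.sum_congr rfl fun k _ => ?_
  unfold gterm
  rw [h, h (k + 1)]
  simp only [derivative_add, derivative_C_mul, Function.iterate_succ_apply']
  simp only [C_add, C_mul]
  ring

/-- The polynomial `μ ↦ f(1;μ)`, where
`f(x;μ) = Σ_{k=0}^n μ^k [A·(d/dx)^k P_n^{(α,β)}(x) + μ·(d/dx)^k P_{n−1}^{(α,β)}(x)]`,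
is Hurwitz stable for `n ≥ 4`, `−1 < α < 1`, `β > 0`, `A > 0`. -/
theorem f_at_one_hurwitz_stable (α β A : ℝ) (n : ℕ) (hn : 4 ≤ n)
    (hα1 : -1 < α) (hα2 : α < 1) (hβ : 0 < β) (hA : 0 < A) :
    HurwitzStable
      (∑ k ∈ Finset.range (n + 1),
        (C (A * (Polynomial.derivative^[k] (jacobiP α β n)).eval 1) * X ^ k +
          C ((Polynomial.derivative^[k] (jacobiP α β (n - 1))).eval 1) * X ^ (k + 1))) := by
  obtain ⟨n, rfl⟩ : ∃ m, n = m + 1 := ⟨n - 1, by omega⟩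
  rw [Nat.add_sub_cancel]
  intro z hz
  rw [map_sum] at hz
  have hr : ∀ k, (z ^ (k + 1)).re = z.re * (z ^ k).re + -z.im * (z ^ k).im := by
    intro k
    rw [pow_succ, Complex.mul_re]
    ring
  have hi : ∀ k, (z ^ (k + 1)).im = z.im * (z ^ k).re + z.re * (z ^ k).im := by
    intro k
    rw [pow_succ, Complex.mul_im]
    ring
  have e1 := gterm_ode α β A z.re (-z.im) n (fun k => (z ^ k).re) (fun k => (z ^ k).im)
    (fun k => (z ^ k).re) hr
  have e2 := gterm_ode α β A z.im z.re n (fun k => (z ^ k).re) (fun k => (z ^ k).im)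
    (fun k => (z ^ k).im) hi
  refine energy α β A z.re z.im n hα1 hα2 hβ hA
    (∑ k ∈ Finset.range (n + 2), gterm α β A n (fun k => (z ^ k).re) k)
    (∑ k ∈ Finset.range (n + 2), gterm α β A n (fun k => (z ^ k).im) k) ?_ ?_
    (gterm_coeff α β A n _) (gterm_coeff α β A n _) ?_ ?_
  · refine Eq.trans ?_ e1
    simp [gterm]
    ring
  · refine Eq.trans ?_ e2
    simp [gterm]
  · have := congrArg Complex.re hz
    rw [Complex.re_sum] at this
    rw [eval_finsetSum]
    refine Eq.trans (Finset.sum_congr rfl fun k _ => ?_) this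
    simp [gterm, aeval_C, ← Complex.ofReal_mul, -Complex.ofReal_mul, Complex.re_ofReal_mul]
    ring
  · have := congrArg Complex.im hz
    rw [Complex.im_sum] at this
    rw [eval_finsetSum]
    refine Eq.trans (Finset.sum_congr rfl fun k _ => ?_) this
    simp [gterm, aeval_C, ← Complex.ofReal_mul, -Complex.ofReal_mul, Complex.im_ofReal_mul]
    ring
end
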